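/- Let 𝐗 = (X, 𝕏, 𝕏(−r)) be a delayed γ-rough path with delay r > 0 and γ ∈ (1/3, 1/2], let 1/3 < β < γ, let σ ∈ C³_b(W², L(ℝ^d, W)) and let ξ ∈ 𝒟_X^β([−r,0], W). Then for every T > 0 the rough delay equation dy_t = σ(y_t, y_{t−r}) d𝐗_t on [0,T] with y|_{[−r,0]} = ξ has a unique solution y, and its Gubinelli derivative is y'_t = σ(y_t, y_{t−r}). -/

import Mathlib

noncomputable section

namespace SDDE

open Set

variable {E E₁ E₂ : Type*}

/-- `f` is `γ`-Hölder continuous on `I`. -/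
def HolderOn [NormedAddCommGroup E] (γ : ℝ) (I : Set ℝ) (f : ℝ → E) : Prop :=
  ∃ C : ℝ, ∀ s ∈ I, ∀ t ∈ I, ‖f t - f s‖ ≤ C * |t - s| ^ γ

/-- The `γ`-Hölder seminorm of `f` on `I`. -/
def holderNorm [NormedAddCommGroup E] (γ : ℝ) (I : Set ℝ) (f : ℝ → E) : ℝ :=
  sInf {C : ℝ | 0 ≤ C ∧ ∀ s ∈ I, ∀ t ∈ I, ‖f t - f s‖ ≤ C * |t - s| ^ γ}

/-- A two-parameter function has finite `γ`-Hölder seminorm on `I`. -/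
def Holder2On [NormedAddCommGroup E] (γ : ℝ) (I : Set ℝ) (F : ℝ → ℝ → E) : Prop :=
  ∃ C : ℝ, ∀ s ∈ I, ∀ t ∈ I, ‖F s t‖ ≤ C * |t - s| ^ γ

/-- The `γ`-Hölder seminorm of a two-parameter function on `I`. -/
def holder2Norm [NormedAddCommGroup E] (γ : ℝ) (I : Set ℝ) (F : ℝ → ℝ → E) : ℝ :=
  sInf {C : ℝ | 0 ≤ C ∧ ∀ s ∈ I, ∀ t ∈ I, ‖F s t‖ ≤ C * |t - s| ^ γ}

/-- A delayed `γ`-rough path with delay `r`: a path `X : ℝ → ℝ^d` together with a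
Lévy area `XX` and a delayed Lévy area `XXd`, satisfying Chen's identities and
Hölder bounds.  The tensor `a ⊗ b ∈ ℝ^d ⊗ ℝ^d` is represented by the matrix
`fun i j => a i * b j`. -/
structure DelayedRoughPath (d : ℕ) (r γ : ℝ) : Type where
  X : ℝ → Fin d → ℝ
  XX : ℝ → ℝ → Fin d → Fin d → ℝ
  XXd : ℝ → ℝ → Fin d → Fin d → ℝ
  holX : ∀ a b : ℝ, HolderOn γ (Icc a b) X
  contXX : Continuous fun p : ℝ × ℝ => XX p.1 p.2
  contXXd : Continuous fun p : ℝ × ℝ => XXd p.1 p.2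
  chen : ∀ s u t : ℝ, XX s t = XX s u + XX u t + fun i j => (X u i - X s i) * (X t j - X u j)
  chend : ∀ s u t : ℝ,
    XXd s t = XXd s u + XXd u t + fun i j => (X (u - r) i - X (s - r) i) * (X t j - X u j)
  holXX : ∀ a b : ℝ, Holder2On (2 * γ) (Icc a b) XX
  holXXd : ∀ a b : ℝ, Holder2On (2 * γ) (Icc a b) XXd

variable {d : ℕ} {r γ : ℝ}

/-- The rough path "norm" `‖RP‖_{γ;[a,b]}`. -/
def DelayedRoughPath.hnorm (RP : DelayedRoughPath d r γ) (a b : ℝ) : ℝ :=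
  holderNorm γ (Icc a b) RP.X + holderNorm γ (Icc (a - r) (b - r)) RP.X +
    Real.sqrt (holder2Norm (2 * γ) (Icc a b) RP.XX) +
    Real.sqrt (holder2Norm (2 * γ) (Icc a b) RP.XXd)

section Controlled

variable [NormedAddCommGroup E] [NormedSpace ℝ E]

/-- `(m, m')` is a `β`-controlled path based on `X` on `I`: `m'` is `β`-Hölder and the
remainder `m_{s,t} - m'_s X_{s,t}` has finite `2β`-Hölder seminorm. -/
def IsControlled (β : ℝ) (X : ℝ → Fin d → ℝ) (I : Set ℝ)
    (m : ℝ → E) (m' : ℝ → (Fin d → ℝ) →L[ℝ] E) : Prop :=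
  HolderOn β I m' ∧
    ∃ C : ℝ, ∀ s ∈ I, ∀ t ∈ I, ‖m t - m s - m' s (X t - X s)‖ ≤ C * |t - s| ^ (2 * β)

/-- The norm of the controlled path `(m, m')` in `𝒟_X^β([a,b])`. -/
def cpNorm (β : ℝ) (X : ℝ → Fin d → ℝ) (a b : ℝ)
    (m : ℝ → E) (m' : ℝ → (Fin d → ℝ) →L[ℝ] E) : ℝ :=
  ‖m a‖ + ‖m' a‖ + holderNorm β (Icc a b) m' +
    sInf {C : ℝ | 0 ≤ C ∧ ∀ s ∈ Icc a b, ∀ t ∈ Icc a b,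
      ‖m t - m s - m' s (X t - X s)‖ ≤ C * |t - s| ^ (2 * β)}

/-- `(m, ζ0, ζ1)` is a delayed `(α, β, θ)`-controlled path based on `X` on `[a,b]`
(with delay `rr`). -/
def IsDelayedControlled (rr α β θ : ℝ) (X : ℝ → Fin d → ℝ) (a b : ℝ)
    (m : ℝ → E) (ζ0 ζ1 : ℝ → (Fin d → ℝ) →L[ℝ] E) : Prop :=
  HolderOn α (Icc a b) m ∧ HolderOn β (Icc a b) ζ0 ∧ HolderOn β (Icc a b) ζ1 ∧
    ∃ C : ℝ, ∀ s ∈ Icc a b, ∀ t ∈ Icc a b,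
      ‖m t - m s - ζ0 s (X t - X s) - ζ1 s (X (t - rr) - X (s - rr))‖ ≤ C * |t - s| ^ θ

/-- The norm on the space `𝒟_X^{α,β,θ}([a,b])` of delayed controlled paths. -/
def dcpNorm (rr α β θ : ℝ) (X : ℝ → Fin d → ℝ) (a b : ℝ)
    (m : ℝ → E) (ζ0 ζ1 : ℝ → (Fin d → ℝ) →L[ℝ] E) : ℝ :=
  ‖m a‖ + ‖ζ0 a‖ + ‖ζ1 a‖ + holderNorm α (Icc a b) m + holderNorm β (Icc a b) ζ0 +
    holderNorm β (Icc a b) ζ1 +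
    sInf {C : ℝ | 0 ≤ C ∧ ∀ s ∈ Icc a b, ∀ t ∈ Icc a b,
      ‖m t - m s - ζ0 s (X t - X s) - ζ1 s (X (t - rr) - X (s - rr))‖ ≤ C * |t - s| ^ θ}

/-- Application of a bilinear-map-valued coefficient to a tensor (matrix). -/
def apply2 (ζ : (Fin d → ℝ) →L[ℝ] ((Fin d → ℝ) →L[ℝ] E)) (M : Fin d → Fin d → ℝ) : E :=
  ∑ i : Fin d, ∑ j : Fin d, M i j • ζ (Pi.single i 1) (Pi.single j 1)

/-- A partition of the interval `[s,t]`. -/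
structure Partition (s t : ℝ) : Type where
  n : ℕ
  pts : ℕ → ℝ
  h0 : pts 0 = s
  hn : pts n = t
  mono : ∀ i < n, pts i ≤ pts (i + 1)

/-- The mesh of the partition is at most `δ`. -/
def Partition.MeshLE {s t : ℝ} (P : Partition s t) (δ : ℝ) : Prop :=
  ∀ i < P.n, P.pts (i + 1) - P.pts i ≤ δ

/-- The compensated Riemann sum of a delayed controlled integrand along a partition. -/
def riemannSum (RP : DelayedRoughPath d r γ) (m : ℝ → (Fin d → ℝ) →L[ℝ] E)
    (ζ0 ζ1 : ℝ → (Fin d → ℝ) →L[ℝ] ((Fin d → ℝ) →L[ℝ] E)) {s t : ℝ} (P : Partition s t) : E :=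
  ∑ i ∈ Finset.range P.n,
    (m (P.pts i) (RP.X (P.pts (i + 1)) - RP.X (P.pts i)) +
      apply2 (ζ0 (P.pts i)) (RP.XX (P.pts i) (P.pts (i + 1))) +
      apply2 (ζ1 (P.pts i)) (RP.XXd (P.pts i) (P.pts (i + 1))))

/-- `v` is the rough delay integral `∫_s^t m dX` of the delayed controlled path
`(m, ζ0, ζ1)` against `RP`: the compensated Riemann sums converge to `v` as the mesh
tends to zero. -/
def HasRoughIntegral (RP : DelayedRoughPath d r γ) (m : ℝ → (Fin d → ℝ) →L[ℝ] E)
    (ζ0 ζ1 : ℝ → (Fin d → ℝ) →L[ℝ] ((Fin d → ℝ) →L[ℝ] E)) (s t : ℝ) (v : E) : Prop :=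
  ∀ ε > (0:ℝ), ∃ δ > (0:ℝ), ∀ P : Partition s t, P.MeshLE δ → ‖riemannSum RP m ζ0 ζ1 P - v‖ ≤ ε

/-- Compensated Riemann sum for the (non-delayed) forward rough integral. -/
def riemannSumFwd (X : ℝ → Fin d → ℝ) (XX : ℝ → ℝ → Fin d → Fin d → ℝ)
    (m : ℝ → (Fin d → ℝ) →L[ℝ] E) (m' : ℝ → (Fin d → ℝ) →L[ℝ] ((Fin d → ℝ) →L[ℝ] E))
    {s t : ℝ} (P : Partition s t) : E :=
  ∑ i ∈ Finset.range P.n,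
    (m (P.pts i) (X (P.pts (i + 1)) - X (P.pts i)) +
      apply2 (m' (P.pts i)) (XX (P.pts i) (P.pts (i + 1))))

/-- The forward rough integral of a controlled path, via left-point compensated sums. -/
def HasFwdIntegral (X : ℝ → Fin d → ℝ) (XX : ℝ → ℝ → Fin d → Fin d → ℝ)
    (m : ℝ → (Fin d → ℝ) →L[ℝ] E) (m' : ℝ → (Fin d → ℝ) →L[ℝ] ((Fin d → ℝ) →L[ℝ] E))
    (s t : ℝ) (v : E) : Prop :=
  ∀ ε > (0:ℝ), ∃ δ > (0:ℝ), ∀ P : Partition s t, P.MeshLE δ →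
    ‖riemannSumFwd X XX m m' P - v‖ ≤ ε

/-- Compensated Riemann sum for the backward rough integral (right endpoints). -/
def riemannSumBwd (X : ℝ → Fin d → ℝ) (XX : ℝ → ℝ → Fin d → Fin d → ℝ)
    (m : ℝ → (Fin d → ℝ) →L[ℝ] E) (m' : ℝ → (Fin d → ℝ) →L[ℝ] ((Fin d → ℝ) →L[ℝ] E))
    {s t : ℝ} (P : Partition s t) : E :=
  ∑ i ∈ Finset.range P.n,
    (m (P.pts (i + 1)) (X (P.pts (i + 1)) - X (P.pts i)) +
      apply2 (m' (P.pts (i + 1))) (XX (P.pts i) (P.pts (i + 1))))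

/-- The backward rough integral, via right-point compensated sums. -/
def HasBwdIntegral (X : ℝ → Fin d → ℝ) (XX : ℝ → ℝ → Fin d → Fin d → ℝ)
    (m : ℝ → (Fin d → ℝ) →L[ℝ] E) (m' : ℝ → (Fin d → ℝ) →L[ℝ] ((Fin d → ℝ) →L[ℝ] E))
    (s t : ℝ) (v : E) : Prop :=
  ∀ ε > (0:ℝ), ∃ δ > (0:ℝ), ∀ P : Partition s t, P.MeshLE δ →
    ‖riemannSumBwd X XX m m' P - v‖ ≤ ε

end Controlled

section Smooth

variable [NormedAddCommGroup E₁] [NormedSpace ℝ E₁] [NormedAddCommGroup E₂] [NormedSpace ℝ E₂]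

/-- `f ∈ C^n_b`: `f` is `n` times continuously differentiable with bounded derivatives
(up to order `n`). -/
def CnBounded (n : ℕ) (f : E₁ → E₂) : Prop :=
  ContDiff ℝ n f ∧ ∀ i : ℕ, i ≤ n → ∃ C : ℝ, ∀ x, ‖iteratedFDeriv ℝ i f x‖ ≤ C

/-- `f ∈ 𝒞^{m+κ}`: derivatives up to order `m` are bounded and continuous and the
`m`-th derivative is `κ`-Hölder. -/
def CHolderClass (m : ℕ) (κ : ℝ) (f : E₁ → E₂) : Prop :=
  ContDiff ℝ m f ∧ (∀ i : ℕ, i ≤ m → ∃ C : ℝ, ∀ x, ‖iteratedFDeriv ℝ i f x‖ ≤ C) ∧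
    ∃ C : ℝ, ∀ x y, ‖iteratedFDeriv ℝ m f x - iteratedFDeriv ℝ m f y‖ ≤ C * ‖x - y‖ ^ κ

end Smooth

section CNdelta

variable {F₁ F₂ : Type*} [AddCommGroup F₁] [Module ℝ F₁] [AddCommGroup F₂] [Module ℝ F₂]

/-- A map `F` between (semi-)normed spaces (seminorms `N₁`, `N₂`) is of class `𝒞^{n+δ}`
on `U`: there exist multilinear derivative maps `D j`, `j ≤ n`, bounded with respect
to the seminorms, where `D (j+1)` is the Fréchet derivative of `D j` on `U` and `D n`
is `δ`-Hölder on `U`. -/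
def IsCNdeltaOn (N₁ : F₁ → ℝ) (N₂ : F₂ → ℝ) (F : F₁ → F₂) (U : Set F₁) (n : ℕ) (δ : ℝ) :
    Prop :=
  ∃ D : (j : ℕ) → F₁ → ((Fin j → F₁) → F₂),
    (∀ x ∈ U, ∀ v : Fin 0 → F₁, D 0 x v = F x) ∧
    (∀ j : ℕ, j ≤ n → ∀ x ∈ U, ∀ (v : Fin j → F₁) (i : Fin j) (a b : F₁) (c : ℝ),
      D j x (Function.update v i (a + b)) =
          D j x (Function.update v i a) + D j x (Function.update v i b) ∧
        D j x (Function.update v i (c • a)) = c • D j x (Function.update v i a)) ∧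
    (∀ j : ℕ, j ≤ n → ∀ x ∈ U, ∃ C : ℝ, ∀ v : Fin j → F₁,
      N₂ (D j x v) ≤ C * ∏ i : Fin j, N₁ (v i)) ∧
    (∀ j : ℕ, j < n → ∀ x ∈ U, ∀ ε > (0:ℝ), ∃ ρ > (0:ℝ), ∀ h : F₁, N₁ h ≤ ρ → x + h ∈ U →
      ∀ v : Fin j → F₁,
        N₂ (D j (x + h) v - D j x v - D (j + 1) x (Fin.cons h v)) ≤
          ε * N₁ h * ∏ i : Fin j, N₁ (v i)) ∧
    ∃ C : ℝ, ∀ x ∈ U, ∀ y ∈ U, ∀ v : Fin n → F₁,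
      N₂ (D n x v - D n y v) ≤ C * N₁ (x - y) ^ δ * ∏ i : Fin n, N₁ (v i)

/-- `F` is locally of class `𝒞^{n+δ}` on `S`. -/
def IsLocallyCNdeltaOn (N₁ : F₁ → ℝ) (N₂ : F₂ → ℝ) (F : F₁ → F₂) (S : Set F₁) (n : ℕ)
    (δ : ℝ) : Prop :=
  ∀ x ∈ S, ∃ ρ > (0:ℝ), IsCNdeltaOn N₁ N₂ F (S ∩ {y | N₁ (y - x) < ρ}) n δ

end CNdelta

section Equation

variable {W : Type*} [NormedAddCommGroup W] [NormedSpace ℝ W]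

/-- The partial derivative `σ_x` of `σ` in the first variable. -/
def sigmaX (σ : W × W → (Fin d → ℝ) →L[ℝ] W) : W × W → W →L[ℝ] ((Fin d → ℝ) →L[ℝ] W) :=
  fun p => (fderiv ℝ σ p).comp (ContinuousLinearMap.inl ℝ W W)

/-- The partial derivative `σ_y` of `σ` in the second variable. -/
def sigmaY (σ : W × W → (Fin d → ℝ) →L[ℝ] W) : W × W → W →L[ℝ] ((Fin d → ℝ) →L[ℝ] W) :=
  fun p => (fderiv ℝ σ p).comp (ContinuousLinearMap.inr ℝ W W)

/-- The Gubinelli derivative of a solution: `ξ'` on `[-r,0)`, `σ(y_t, y_{t-r})` for `t ≥ 0`. -/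
def solDeriv (σ : W × W → (Fin d → ℝ) →L[ℝ] W) (rr : ℝ)
    (ξ' : ℝ → (Fin d → ℝ) →L[ℝ] W) (y : ℝ → W) : ℝ → (Fin d → ℝ) →L[ℝ] W :=
  fun t => if t < 0 then ξ' t else σ (y t, y (t - rr))

/-- `ζ⁰` component of the integrand `τ ↦ σ(y_τ, y_{τ-r})`:  `σ_x(y_τ, y_{τ-r}) y'_τ`. -/
def zeta0 (σ : W × W → (Fin d → ℝ) →L[ℝ] W) (rr : ℝ) (y : ℝ → W)
    (y' : ℝ → (Fin d → ℝ) →L[ℝ] W) : ℝ → (Fin d → ℝ) →L[ℝ] ((Fin d → ℝ) →L[ℝ] W) :=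
  fun τ => (sigmaX σ (y τ, y (τ - rr))).comp (y' τ)

/-- `ζ¹` component of the integrand `τ ↦ σ(y_τ, y_{τ-r})`:  `σ_y(y_τ, y_{τ-r}) y'_{τ-r}`. -/
def zeta1 (σ : W × W → (Fin d → ℝ) →L[ℝ] W) (rr : ℝ) (y : ℝ → W)
    (y' : ℝ → (Fin d → ℝ) →L[ℝ] W) : ℝ → (Fin d → ℝ) →L[ℝ] ((Fin d → ℝ) →L[ℝ] W) :=
  fun τ => (sigmaY σ (y τ, y (τ - rr))).comp (y' (τ - rr))

/-- `y` solves `dy_t = B(y_t, y_{t-r}) dt + σ(y_t, y_{t-r}) dRP_t` on `[0,T]` with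
initial condition `(ξ, ξ')` on `[-r,0]`:  `y = ξ` on `[-r,0]`, on each interval
`[kr, (k+1)r] ∩ [0,T]` the path is `β`-controlled with Gubinelli derivative
`y'_t = σ(y_t, y_{t-r})`, and the integral identity holds for `0 ≤ s ≤ t ≤ T`. -/
def IsSolOnT (RP : DelayedRoughPath d r γ) (σ : W × W → (Fin d → ℝ) →L[ℝ] W)
    (B : W × W →ₗ[ℝ] W) (β : ℝ) (ξ : ℝ → W) (ξ' : ℝ → (Fin d → ℝ) →L[ℝ] W)
    (T : ℝ) (y : ℝ → W) : Prop :=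
  (∀ t ∈ Icc (-r) 0, y t = ξ t) ∧
    (∀ k : ℕ, (k : ℝ) * r ≤ T →
      IsControlled β RP.X (Icc ((k : ℝ) * r) (min (((k : ℝ) + 1) * r) T)) y
        (solDeriv σ r ξ' y)) ∧
    ∀ s t : ℝ, 0 ≤ s → s ≤ t → t ≤ T →
      HasRoughIntegral RP (fun τ => σ (y τ, y (τ - r)))
        (zeta0 σ r y (solDeriv σ r ξ' y)) (zeta1 σ r y (solDeriv σ r ξ' y)) s t
        (y t - y s - ∫ τ in s..t, B (y τ, y (τ - r)))

/-- `y` solves `dy_t = B(y_t, y_{t-r}) dt + σ(y_t, y_{t-r}) dRP_t` on `[0,r]` with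
initial condition `(ξ, ξ')` on `[-r,0]`. -/
def IsSolOn (RP : DelayedRoughPath d r γ) (σ : W × W → (Fin d → ℝ) →L[ℝ] W)
    (B : W × W →ₗ[ℝ] W) (β : ℝ) (ξ : ℝ → W) (ξ' : ℝ → (Fin d → ℝ) →L[ℝ] W)
    (y : ℝ → W) : Prop :=
  (∀ t ∈ Icc (-r) 0, y t = ξ t) ∧
    IsControlled β RP.X (Icc 0 r) y (solDeriv σ r ξ' y) ∧
    ∀ t ∈ Icc 0 r,
      HasRoughIntegral RP (fun τ => σ (y τ, y (τ - r)))
        (zeta0 σ r y (solDeriv σ r ξ' y)) (zeta1 σ r y (solDeriv σ r ξ' y)) 0 t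
        (y t - ξ 0 - ∫ τ in (0:ℝ)..t, B (y τ, y (τ - r)))

/-- The solution map `ξ ↦ y^ξ` on pairs (path, Gubinelli derivative). -/
def solMap (RP : DelayedRoughPath d r γ) (σ : W × W → (Fin d → ℝ) →L[ℝ] W)
    (B : W × W →ₗ[ℝ] W) (β : ℝ) :
    ((ℝ → W) × (ℝ → (Fin d → ℝ) →L[ℝ] W)) → ((ℝ → W) × (ℝ → (Fin d → ℝ) →L[ℝ] W)) :=
  fun p =>
    @dite _ (∃ y : ℝ → W, IsSolOn RP σ B β p.1 p.2 y) (Classical.dec _)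
      (fun h => (h.choose, solDeriv σ r p.2 h.choose)) (fun _ => 0)

/-- `D` is the Fréchet derivative of the solution map at the controlled path `p`:
`D` is a bounded linear map (w.r.t. the controlled path norms) and
`‖solMap (p+h) - solMap p - D h‖ = o(‖h‖)` on controlled directions `h`. -/
def IsSolMapDerivAt (RP : DelayedRoughPath d r γ) (σ : W × W → (Fin d → ℝ) →L[ℝ] W)
    (B : W × W →ₗ[ℝ] W) (β : ℝ) (p : (ℝ → W) × (ℝ → (Fin d → ℝ) →L[ℝ] W))
    (D : ((ℝ → W) × (ℝ → (Fin d → ℝ) →L[ℝ] W)) →ₗ[ℝ]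
      ((ℝ → W) × (ℝ → (Fin d → ℝ) →L[ℝ] W))) : Prop :=
  (∃ C : ℝ, 0 ≤ C ∧ ∀ q : (ℝ → W) × (ℝ → (Fin d → ℝ) →L[ℝ] W),
    IsControlled β RP.X (Icc (-r) 0) q.1 q.2 →
      cpNorm β RP.X 0 r (D q).1 (D q).2 ≤ C * cpNorm β RP.X (-r) 0 q.1 q.2) ∧
    ∀ ε > (0:ℝ), ∃ δ > (0:ℝ), ∀ h : (ℝ → W) × (ℝ → (Fin d → ℝ) →L[ℝ] W),
      IsControlled β RP.X (Icc (-r) 0) h.1 h.2 → cpNorm β RP.X (-r) 0 h.1 h.2 ≤ δ →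
        cpNorm β RP.X 0 r (solMap RP σ B β (p + h) - solMap RP σ B β p - D h).1
            (solMap RP σ B β (p + h) - solMap RP σ B β p - D h).2 ≤
          ε * cpNorm β RP.X (-r) 0 h.1 h.2

/-- The map `(a,b,c,e) ↦ σ_x(a,b) c + σ_y(a,b) e` appearing in the linearized equation. -/
def PhiLin (σ : W × W → (Fin d → ℝ) →L[ℝ] W) : W × W × W × W → (Fin d → ℝ) →L[ℝ] W :=
  fun p => sigmaX σ (p.1, p.2.1) p.2.2.1 + sigmaY σ (p.1, p.2.1) p.2.2.2

/-- The integrand `τ ↦ σ_x(y_τ, ξ_{τ-r}) Z_τ + σ_y(y_τ, ξ_{τ-r}) η_{τ-r}` of the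
linearized equation. -/
def linInt (σ : W × W → (Fin d → ℝ) →L[ℝ] W) (rr : ℝ) (ξ y Z ηf : ℝ → W) :
    ℝ → (Fin d → ℝ) →L[ℝ] W :=
  fun τ => sigmaX σ (y τ, ξ (τ - rr)) (Z τ) + sigmaY σ (y τ, ξ (τ - rr)) (ηf (τ - rr))

/-- The `ζ⁰` component of the linearized integrand, via the Leibniz rule. -/
def zeta0lin (σ : W × W → (Fin d → ℝ) →L[ℝ] W) (rr : ℝ) (ξ y Z ηf : ℝ → W)
    (y' Z' : ℝ → (Fin d → ℝ) →L[ℝ] W) : ℝ → (Fin d → ℝ) →L[ℝ] ((Fin d → ℝ) →L[ℝ] W) :=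
  fun τ => (fderiv ℝ (PhiLin σ) (y τ, ξ (τ - rr), Z τ, ηf (τ - rr))).comp
    ((y' τ).prod (((0 : (Fin d → ℝ) →L[ℝ] W)).prod ((Z' τ).prod (0 : (Fin d → ℝ) →L[ℝ] W))))

/-- The `ζ¹` component of the linearized integrand, via the Leibniz rule. -/
def zeta1lin (σ : W × W → (Fin d → ℝ) →L[ℝ] W) (rr : ℝ) (ξ y Z ηf : ℝ → W)
    (ξ' η' : ℝ → (Fin d → ℝ) →L[ℝ] W) : ℝ → (Fin d → ℝ) →L[ℝ] ((Fin d → ℝ) →L[ℝ] W) :=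
  fun τ => (fderiv ℝ (PhiLin σ) (y τ, ξ (τ - rr), Z τ, ηf (τ - rr))).comp
    (((0 : (Fin d → ℝ) →L[ℝ] W)).prod
      ((ξ' (τ - rr)).prod (((0 : (Fin d → ℝ) →L[ℝ] W)).prod (η' (τ - rr)))))

/-- `Z` solves the linearized rough delay equation along `y = y^ξ` in the direction
`(η, η')`, i.e. `Z_t = η_0 + ∫_0^t B(Z_τ, η_{τ-r}) dτ
 + ∫_0^t [σ_x(y_τ, ξ_{τ-r}) Z_τ + σ_y(y_τ, ξ_{τ-r}) η_{τ-r}] dRP_τ` on `[0,r]`,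
`Z = η` on `[-r,0]`, with the Gubinelli derivative given by the integrand. -/
def IsLinSolOn (RP : DelayedRoughPath d r γ) (σ : W × W → (Fin d → ℝ) →L[ℝ] W)
    (B : W × W →ₗ[ℝ] W) (β : ℝ) (ξ ηf : ℝ → W) (ξ' η' : ℝ → (Fin d → ℝ) →L[ℝ] W)
    (y : ℝ → W) (Z : ℝ → W) : Prop :=
  (∀ t ∈ Icc (-r) 0, Z t = ηf t) ∧
    IsControlled β RP.X (Icc 0 r) Z
      (fun τ => if τ < 0 then η' τ else linInt σ r ξ y Z ηf τ) ∧
    ∀ t ∈ Icc 0 r,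
      HasRoughIntegral RP (linInt σ r ξ y Z ηf)
        (zeta0lin σ r ξ y Z ηf (solDeriv σ r ξ' y)
          (fun τ => if τ < 0 then η' τ else linInt σ r ξ y Z ηf τ))
        (zeta1lin σ r ξ y Z ηf ξ' η') 0 t
        (Z t - ηf 0 - ∫ τ in (0:ℝ)..t, B (Z τ, ηf (τ - r)))

/-- `y` solves the frozen-delay equation `y_t = x + ∫_s^t σ(y_τ, ξ_{τ-r}) dRP_τ` on `[s,r]`
with Gubinelli derivative `σ(y_·, ξ_{·-r})`. -/
def IsFrozenSol (RP : DelayedRoughPath d r γ) (σ : W × W → (Fin d → ℝ) →L[ℝ] W) (β : ℝ)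
    (ξ : ℝ → W) (ξ' : ℝ → (Fin d → ℝ) →L[ℝ] W) (s : ℝ) (x : W) (y : ℝ → W) : Prop :=
  y s = x ∧
    IsControlled β RP.X (Icc s r) y (fun τ => σ (y τ, ξ (τ - r))) ∧
    ∀ t ∈ Icc s r,
      HasRoughIntegral RP (fun τ => σ (y τ, ξ (τ - r)))
        (fun τ => (sigmaX σ (y τ, ξ (τ - r))).comp (σ (y τ, ξ (τ - r))))
        (fun τ => (sigmaY σ (y τ, ξ (τ - r))).comp (ξ' (τ - r))) s t (y t - x)

/-- The solution flow `φ̄(s, ·, x)` of the frozen-delay equation. -/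
def frozenFlow (RP : DelayedRoughPath d r γ) (σ : W × W → (Fin d → ℝ) →L[ℝ] W) (β : ℝ)
    (ξ : ℝ → W) (ξ' : ℝ → (Fin d → ℝ) →L[ℝ] W) (s : ℝ) (x : W) : ℝ → W :=
  @dite _ (∃ y : ℝ → W, IsFrozenSol RP σ β ξ ξ' s x y) (Classical.dec _)
    (fun h => h.choose) (fun _ => fun _ => x)

end Equation

end SDDE

noncomputable section

namespace SDDEP
open Set Filter Topology

section Abstract
variable {W : Type*} [NormedAddCommGroup W]

/-- Defect of the almost flow `x ↦ x + ν s t x`. -/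
def dfct (ν : ℝ → ℝ → W → W) (s u t : ℝ) (x : W) : W :=
  ν s u x + ν u t (x + ν s u x) - ν s t x

/-- Almost flows. -/
structure AF (β K A B : ℝ) (ν : ℝ → ℝ → W → W) : Prop where
  K0 : 0 ≤ K
  zero : ∀ s x, ν s s x = 0
  lip : ∀ s t, A ≤ s → s ≤ t → t ≤ B → ∀ x x',
    ‖ν s t x - ν s t x'‖ ≤ K * (t - s) ^ β * ‖x - x'‖
  four : ∀ s t, A ≤ s → s ≤ t → t ≤ B → ∀ a d a' d',
    ‖(ν s t (a + d) - ν s t a) - (ν s t (a' + d') - ν s t a')‖ ≤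
      K * (t - s) ^ β * (‖d - d'‖ + ‖a - a'‖ * ‖d‖)
  dfc : ∀ s u t, A ≤ s → s ≤ u → u ≤ t → t ≤ B → ∀ x,
    ‖dfct ν s u t x‖ ≤ K * (t - s) ^ (3 * β)
  dfl : ∀ s u t, A ≤ s → s ≤ u → u ≤ t → t ≤ B → ∀ x x',
    ‖dfct ν s u t x - dfct ν s u t x'‖ ≤ K * (t - s) ^ (3 * β) * ‖x - x'‖

/-- Davie's estimate. -/
def Dav (β C a b : ℝ) (ν : ℝ → ℝ → W → W) (y : ℝ → W) : Prop :=
  ∀ s t, a ≤ s → s ≤ t → t ≤ b → ‖y t - y s - ν s t (y s)‖ ≤ C * (t - s) ^ (3 * β)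

lemma AF.mono {β K A B A' B' : ℝ} {ν : ℝ → ℝ → W → W} (h : AF β K A B ν)
    (hA : A ≤ A') (hB : B' ≤ B) : AF β K A' B' ν where
  K0 := h.K0
  zero := h.zero
  lip := fun s t h1 h2 h3 => h.lip s t (hA.trans h1) h2 (h3.trans hB)
  four := fun s t h1 h2 h3 => h.four s t (hA.trans h1) h2 (h3.trans hB)
  dfc := fun s u t h1 h2 h3 h4 => h.dfc s u t (hA.trans h1) h2 h3 (h4.trans hB)
  dfl := fun s u t h1 h2 h3 h4 => h.dfl s u t (hA.trans h1) h2 h3 (h4.trans hB)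

lemma Dav.mono {β C a b a' b' : ℝ} {ν : ℝ → ℝ → W → W} {y : ℝ → W} (h : Dav β C a b ν y)
    (hA : a ≤ a') (hB : b' ≤ b) : Dav β C a' b' ν y :=
  fun s t h1 h2 h3 => h s t (hA.trans h1) h2 (h3.trans hB)

lemma Dav.le {β C C' a b : ℝ} {ν : ℝ → ℝ → W → W} {y : ℝ → W} (h : Dav β C a b ν y)
    (hC : C ≤ C') : Dav β C' a b ν y :=
  fun s t h1 h2 h3 => (h s t h1 h2 h3).trans
    (mul_le_mul_of_nonneg_right hC (Real.rpow_nonneg (sub_nonneg.2 h2) _))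

/-- Euler scheme along a finite set. -/
def Euler (ν : ℝ → ℝ → W → W) (F : Finset ℝ) (y : ℝ → W) : Prop :=
  ∀ u ∈ F, ∀ v ∈ F, u < v → (∀ w ∈ F, ¬ (u < w ∧ w < v)) → y v = y u + ν u v (y u)

lemma euler_exists (ν : ℝ → ℝ → W → W) (a : ℝ) (x : W) (F : Finset ℝ) :
    (∀ s ∈ F, a ≤ s) → ∃ y : ℝ → W, y a = x ∧ Euler ν F y := by
  induction F using Finset.induction_on_max with
  | empty => intro _; exact ⟨fun _ => x, rfl, by intro u hu; simp at hu⟩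
  | insert m F hm ih =>
    intro hF
    obtain ⟨y, hy, hE⟩ := ih (fun s hs => hF s (Finset.mem_insert_of_mem hs))
    by_cases hne : F.Nonempty
    · set p := F.max' hne
      have hpF : p ∈ F := F.max'_mem hne
      have hpm : p < m := hm p hpF
      have hap : a ≤ p := hF p (Finset.mem_insert_of_mem hpF)
      refine ⟨Function.update y m (y p + ν p m (y p)), ?_, ?_⟩
      · rw [Function.update_of_ne (by intro h; linarith)]; exact hy
      · intro u hu v hv huv hw
        have hum : u ≠ m := by
          rintro rfl
          rcases Finset.mem_insert.1 hv with h | h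
          · linarith
          · linarith [hm v h]
        have huF : u ∈ F := (Finset.mem_insert.1 hu).resolve_left hum
        rw [Function.update_of_ne hum]
        rcases Finset.mem_insert.1 hv with h | h
        · subst h
          have : u = p := by
            rcases (F.le_max' u huF).lt_or_eq with h | h
            · exact absurd ⟨h, hpm⟩ (hw p (Finset.mem_insert_of_mem hpF))
            · exact h
          rw [Function.update_self, this]
        · rw [Function.update_of_ne (hm v h).ne]
          exact hE u huF v h huv (fun w hwF => hw w (Finset.mem_insert_of_mem hwF))
    · rw [Finset.not_nonempty_iff_eq_empty] at hne
      subst hne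
      refine ⟨y, hy, ?_⟩
      intro u hu v hv huv
      simp at hu hv
      subst hu; subst hv; exact absurd huv (lt_irrefl _)


/-- Choice of the small constant. -/
lemma exists_kappa {β : ℝ} (hβ : 1 / 3 < β) :
    ∃ k : ℝ, 0 < k ∧ k ≤ 1 ∧ ((1:ℝ) / 2) ^ (3 * β) * (2 + 3 * k) < 1 := by
  set c : ℝ := ((1:ℝ) / 2) ^ (3 * β) with hc
  have hc0 : 0 < c := Real.rpow_pos_of_pos (by norm_num) _
  have hc1 : c < 1 / 2 := by
    have := Real.rpow_lt_rpow_of_exponent_gt (by norm_num : (0:ℝ) < 1 / 2) (by norm_num)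
      (by linarith : 1 < 3 * β)
    rw [Real.rpow_one] at this; exact this
  refine ⟨min 1 ((1 - 2 * c) / (6 * c)), lt_min one_pos (by apply div_pos <;> linarith),
    min_le_left _ _, ?_⟩
  have h1 := min_le_right 1 ((1 - 2 * c) / (6 * c))
  have h2 : c * (3 * min 1 ((1 - 2 * c) / (6 * c))) ≤ c * (3 * ((1 - 2 * c) / (6 * c))) := by
    gcongr
  have h3 : c * (3 * ((1 - 2 * c) / (6 * c))) = (1 - 2 * c) / 2 := by field_simp; ring
  nlinarith

lemma exists_delta {β : ℝ} (hβ : 0 < β) (K : ℝ) {ε : ℝ} (hε : 0 < ε) :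
    ∃ δ : ℝ, 0 < δ ∧ K * δ ^ β ≤ ε := by
  have h : Tendsto (fun x : ℝ => K * x ^ β) (𝓝[>] 0) (𝓝 (K * 0 ^ β)) := by
    apply Tendsto.const_mul
    exact ((Real.continuousAt_rpow_const 0 β (Or.inr hβ.le)).tendsto).mono_left nhdsWithin_le_nhds
  rw [Real.zero_rpow hβ.ne', mul_zero] at h
  have h1 := h.eventually_lt_const hε
  have h2 : ∀ᶠ x in 𝓝[>] (0:ℝ), 0 < x := eventually_mem_nhdsWithin
  obtain ⟨x, hx, hx0⟩ := (h1.and h2).exists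
  exact ⟨x, hx0, hx.le⟩

lemma half_rpow {p x : ℝ} (hx : 0 ≤ x) : (x / 2) ^ p = ((1:ℝ) / 2) ^ p * x ^ p := by
  rw [← Real.mul_rpow (by norm_num) hx]; congr 1; ring

lemma euler_dav {β K A B : ℝ} {ν : ℝ → ℝ → W → W} (h : AF β K A B ν) (hβ : 1 / 3 < β)
    {k δ₀ M : ℝ} (hk0 : 0 ≤ k) (hk1 : k ≤ 1) (hM0 : 0 ≤ M)
    (hδ : K * δ₀ ^ β ≤ k) (hM : M * (((1:ℝ) / 2) ^ (3 * β) * (2 + 3 * k)) + 3 * K ≤ M)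
    (F : Finset ℝ) (y : ℝ → W) (hE : Euler ν F y) (n : ℕ) :
    ∀ s t, s ∈ F → t ∈ F → A ≤ s → s ≤ t → t ≤ B → t - s ≤ δ₀ →
      (F.filter (fun w => s ≤ w ∧ w ≤ t)).card ≤ n →
      ‖y t - y s - ν s t (y s)‖ ≤ M * (t - s) ^ (3 * β) := by
  induction n with
  | zero =>
    intro s t hs ht _ hst _ _ hc
    exfalso
    have : s ∈ F.filter (fun w => s ≤ w ∧ w ≤ t) := by simp [hs, hst]
    have := Finset.card_pos.2 ⟨s, this⟩
    omega
  | succ n ih =>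
    intro s t hs ht hAs hst htB hts hc
    have hK := h.K0
    rcases hst.eq_or_lt with rfl | hlt
    · simp only [sub_self, h.zero, norm_zero]
      positivity
    -- splitting
    set m := (s + t) / 2 with hm
    have hne1 : (F.filter (fun w => s ≤ w ∧ w ≤ m)).Nonempty :=
      ⟨s, by simp [hs]; linarith⟩
    have hne2 : (F.filter (fun w => m < w ∧ w ≤ t)).Nonempty :=
      ⟨t, by simp [ht]; linarith⟩
    set u := (F.filter (fun w => s ≤ w ∧ w ≤ m)).max' hne1 with hu
    set v := (F.filter (fun w => m < w ∧ w ≤ t)).min' hne2 with hv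
    have hu1 := Finset.mem_filter.1 (Finset.max'_mem _ hne1)
    have hv1 := Finset.mem_filter.1 (Finset.min'_mem _ hne2)
    rw [← hu] at hu1
    rw [← hv] at hv1
    obtain ⟨huF, hsu, hum⟩ := hu1
    obtain ⟨hvF, hmv, hvt⟩ := hv1
    have huv : u < v := lt_of_le_of_lt hum hmv
    have hcons : ∀ w ∈ F, ¬ (u < w ∧ w < v) := by
      rintro w hw ⟨h1, h2⟩
      by_cases hwm : w ≤ m
      · have : w ≤ u := Finset.le_max' _ w (by simp [hw, hwm]; linarith)
        linarith
      · have : v ≤ w := Finset.min'_le _ w (by simp [hw]; constructor <;> linarith)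
        linarith
    have hyv := hE u huF v hvF huv hcons
    have c1 : (F.filter (fun w => s ≤ w ∧ w ≤ u)).card ≤ n := by
      have : (F.filter (fun w => s ≤ w ∧ w ≤ u)) ⊂ F.filter (fun w => s ≤ w ∧ w ≤ t) := by
        rw [Finset.ssubset_iff_of_subset]
        · exact ⟨t, by simp [ht, hst], by simp; intros; linarith⟩
        · intro w; simp; intros; refine ⟨?_, ?_, ?_⟩ <;> first | assumption | linarith
      have := Finset.card_lt_card this
      omega
    have c2 : (F.filter (fun w => v ≤ w ∧ w ≤ t)).card ≤ n := by
      have : (F.filter (fun w => v ≤ w ∧ w ≤ t)) ⊂ F.filter (fun w => s ≤ w ∧ w ≤ t) := by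
        rw [Finset.ssubset_iff_of_subset]
        · exact ⟨s, by simp [hs, hst], by simp; intros; linarith⟩
        · intro w; simp; intros; refine ⟨?_, ?_, ?_⟩ <;> first | assumption | linarith
      have := Finset.card_lt_card this
      omega
    have i1 := ih s u hs huF hAs hsu (by linarith) (by linarith) c1
    have i2 := ih v t hvF ht (by linarith) hvt htB (by linarith) c2
    set D := (t - s) ^ (3 * β) with hD
    set c := ((1:ℝ) / 2) ^ (3 * β) with hcdef
    have hc0 : 0 ≤ c := by positivity
    have hD0 : 0 ≤ D := Real.rpow_nonneg (by linarith) _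
    have hp : ∀ a b, 0 ≤ b - a → b - a ≤ (t - s) / 2 → (b - a) ^ (3 * β) ≤ c * D := by
      intro a b h0 h1
      rw [hcdef, hD, ← half_rpow (by linarith)]
      exact Real.rpow_le_rpow h0 h1 (by linarith)
    have hb : ∀ a b, 0 ≤ b - a → b - a ≤ δ₀ → K * (b - a) ^ β ≤ k := by
      intro a b h0 h1
      refine le_trans ?_ hδ
      have := Real.rpow_le_rpow h0 h1 (by linarith : 0 ≤ β)
      gcongr
    have i1' : ‖y u - y s - ν s u (y s)‖ ≤ M * (c * D) :=
      i1.trans (by gcongr; exact hp _ _ (by linarith) (by linarith))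
    have i2' : ‖y t - y v - ν v t (y v)‖ ≤ M * (c * D) :=
      i2.trans (by gcongr; exact hp _ _ (by linarith) (by linarith))
    -- Lipschitz steps
    have hlip : ∀ a b, A ≤ a → a ≤ b → b ≤ B → b - a ≤ δ₀ → ∀ p q : W,
        ‖(p + ν a b p) - (q + ν a b q)‖ ≤ (1 + k) * ‖p - q‖ := by
      intro a b h1 h2 h3 h4 p q
      have e : (p + ν a b p) - (q + ν a b q) = (p - q) + (ν a b p - ν a b q) := by abel
      rw [e]
      have l1 := h.lip a b h1 h2 h3 p q
      have l2 := hb a b (by linarith) h4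
      calc _ ≤ ‖p - q‖ + ‖ν a b p - ν a b q‖ := norm_add_le _ _
        _ ≤ ‖p - q‖ + k * ‖p - q‖ := by
          gcongr; exact l1.trans (by gcongr)
        _ = _ := by ring
    set q := y s + ν s u (y s) with hq
    have j1 : ‖y u - q‖ ≤ M * (c * D) := by
      rw [hq, ← sub_sub]; exact i1'
    have j2 : ‖y v - (q + ν u v q)‖ ≤ (1 + k) * (M * (c * D)) := by
      rw [hyv]
      refine (hlip u v (by linarith) huv.le (by linarith) (by linarith) _ _).trans ?_
      gcongr
    have j3 : ‖(q + ν u v q) - (y s + ν s v (y s))‖ ≤ K * D := by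
      have e : (q + ν u v q) - (y s + ν s v (y s)) = dfct ν s u v (y s) := by
        rw [hq]; unfold dfct; abel
      rw [e]
      refine (h.dfc s u v hAs hsu huv.le (by linarith) _).trans ?_
      gcongr
      exact Real.rpow_le_rpow (by linarith) (by linarith) (by linarith)
    have j4 : ‖y v - (y s + ν s v (y s))‖ ≤ (1 + k) * (M * (c * D)) + K * D := by
      calc _ = ‖(y v - (q + ν u v q)) + ((q + ν u v q) - (y s + ν s v (y s)))‖ := by
            congr 1; abel
        _ ≤ _ := (norm_add_le _ _).trans (add_le_add j2 j3)
    set q' := y s + ν s v (y s) with hq'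
    have j5 : ‖(y v + ν v t (y v)) - (q' + ν v t q')‖ ≤
        (1 + k) * ((1 + k) * (M * (c * D)) + K * D) := by
      refine (hlip v t (by linarith) hvt htB (by linarith) _ _).trans ?_
      gcongr
    have j6 : ‖(q' + ν v t q') - (y s + ν s t (y s))‖ ≤ K * D := by
      have e : (q' + ν v t q') - (y s + ν s t (y s)) = dfct ν s v t (y s) := by
        rw [hq']; unfold dfct; abel
      rw [e]
      exact h.dfc s v t hAs (by linarith) hvt htB _
    have e : y t - y s - ν s t (y s) = (y t - y v - ν v t (y v)) +
        ((y v + ν v t (y v)) - (q' + ν v t q')) +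
        ((q' + ν v t q') - (y s + ν s t (y s))) := by abel
    rw [e]
    have hfin := (norm_add₃_le.trans (add_le_add (add_le_add i2' j5) j6))
    refine hfin.trans ?_
    have hMD : 0 ≤ M * (c * D) := by positivity
    have hKD : 0 ≤ K * D := by positivity
    have hkk : k * k ≤ k := by nlinarith
    have hmul := mul_le_mul_of_nonneg_right hM hD0
    have a1 : k * k * (M * (c * D)) ≤ k * (M * (c * D)) := by gcongr
    have a2 : k * (K * D) ≤ 1 * (K * D) := by gcongr
    nlinarith

lemma exists_local [ProperSpace W] {β K A B : ℝ} {ν : ℝ → ℝ → W → W} (h : AF β K A B ν)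
    (hβ : 1 / 3 < β) : ∃ δ₀ > (0:ℝ), ∃ M : ℝ, 0 ≤ M ∧ ∀ a b : ℝ, A ≤ a → a ≤ b → b ≤ B →
      b - a ≤ δ₀ → ∀ x : W, ∃ y : ℝ → W, y a = x ∧ Dav β M a b ν y := by
  obtain ⟨k, hk0, hk1, hk⟩ := exists_kappa hβ
  obtain ⟨δ₀, hδ0, hδ⟩ := exists_delta (by linarith : 0 < β) K hk0
  have hK := h.K0
  set c := ((1:ℝ) / 2) ^ (3 * β) * (2 + 3 * k) with hc
  set M := 3 * K / (1 - c) with hMdef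
  have hM0 : 0 ≤ M := by apply div_nonneg <;> linarith
  have hM : M * c + 3 * K ≤ M := by
    have : M * (1 - c) = 3 * K := by rw [hMdef]; field_simp [(by linarith : 1 - c ≠ 0)]
    linarith
  refine ⟨δ₀, hδ0, M, hM0, ?_⟩
  intro a b hAa hab hbB hba x
  let G : Finset ℝ → Finset ℝ := fun F => insert a (F.filter (fun w => a ≤ w ∧ w ≤ b))
  have hG : ∀ F, ∀ s ∈ G F, a ≤ s ∧ s ≤ b := by
    intro F s hs
    rcases Finset.mem_insert.1 hs with rfl | hs
    · exact ⟨le_rfl, hab⟩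
    · exact (Finset.mem_filter.1 hs).2
  choose Y hYa hYE using fun F => euler_exists ν a x (G F) (fun s hs => (hG F s hs).1)
  have hdav : ∀ F, ∀ s ∈ G F, ∀ t ∈ G F, s ≤ t →
      ‖Y F t - Y F s - ν s t (Y F s)‖ ≤ M * (t - s) ^ (3 * β) := by
    intro F s hs t ht hst
    have h1 := hG F s hs
    have h2 := hG F t ht
    exact euler_dav h hβ hk0.le hk1 hM0 hδ hM (G F) (Y F) (hYE F) _ s t hs ht
      (by linarith) hst (by linarith) (by linarith) le_rfl
  let U : Ultrafilter (Finset ℝ) := Ultrafilter.of atTop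
  have hU : (U : Filter (Finset ℝ)) ≤ atTop := Ultrafilter.of_le _
  have hmem : ∀ t, a ≤ t → t ≤ b → ∀ᶠ F in (U : Filter (Finset ℝ)), t ∈ G F := by
    intro t h1 h2
    have : ∀ᶠ F in (atTop : Filter (Finset ℝ)), t ∈ G F := by
      filter_upwards [eventually_ge_atTop {t}] with F hF
      apply Finset.mem_insert_of_mem
      simp [h1, h2, hF (Finset.mem_singleton_self t)]
    exact hU this
  have hlim : ∀ t, ∃ l : W, a ≤ t → t ≤ b →
      Tendsto (fun F => Y F t) (U : Filter (Finset ℝ)) (𝓝 l) := by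
    intro t
    by_cases ht : a ≤ t ∧ t ≤ b
    · have hev : ∀ᶠ F in (U : Filter (Finset ℝ)),
          Y F t ∈ Metric.closedBall (x + ν a t x) (M * (t - a) ^ (3 * β)) := by
        filter_upwards [hmem t ht.1 ht.2] with F hF
        have := hdav F a (Finset.mem_insert_self _ _) t hF ht.1
        rw [hYa] at this
        rw [mem_closedBall_iff_norm, ← sub_sub]
        exact this
      have hcomp := isCompact_closedBall (x + ν a t x) (M * (t - a) ^ (3 * β))
      obtain ⟨l, _, hl⟩ := hcomp.ultrafilter_le_nhds (U.map (fun F => Y F t))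
        (le_principal_iff.2 hev)
      exact ⟨l, fun _ _ => hl⟩
    · exact ⟨0, fun h1 h2 => absurd ⟨h1, h2⟩ ht⟩
  choose y hy using hlim
  refine ⟨y, ?_, ?_⟩
  · have := hy a le_rfl hab
    simp only [hYa] at this
    exact (tendsto_nhds_unique this tendsto_const_nhds)
  · intro s t h1 h2 h3
    have l1 := hy s h1 (by linarith)
    have l2 := hy t (by linarith) h3
    have hcont : Continuous (ν s t) := by
      have : LipschitzWith (Real.toNNReal (K * (t - s) ^ β)) (ν s t) := by
        apply LipschitzWith.of_dist_le_mul
        intro p q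
        rw [dist_eq_norm, dist_eq_norm]
        refine (h.lip s t (by linarith) h2 (by linarith) p q).trans ?_
        gcongr
        exact Real.le_coe_toNNReal _
      exact this.continuous
    have l3 := (hcont.tendsto (y s)).comp l1
    have l4 := ((l2.sub l1).sub l3).norm
    refine le_of_tendsto l4 ?_
    filter_upwards [hmem s h1 (by linarith), hmem t (by linarith) h3] with F hF1 hF2
    exact hdav F s hF1 t hF2 h2

lemma dav_concat {β K A B : ℝ} {ν : ℝ → ℝ → W → W} (h : AF β K A B ν) (hβ : 0 < β)
    {a c b C : ℝ} (hAa : A ≤ a) (hac : a ≤ c) (hcb : c ≤ b) (hbB : b ≤ B) (hC : 0 ≤ C)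
    {y : ℝ → W} (h1 : Dav β C a c ν y) (h2 : Dav β C c b ν y) :
    Dav β (C + (C + K * (b - a) ^ β * C) + K) a b ν y := by
  have hK := h.K0
  intro s t has hst htb
  have hD0 : 0 ≤ (t - s) ^ (3 * β) := Real.rpow_nonneg (by linarith) _
  have hE0 : 0 ≤ (b - a) ^ β := Real.rpow_nonneg (by linarith) _
  by_cases htc : t ≤ c
  · refine (h1 s t has hst htc).trans ?_
    gcongr
    nlinarith [mul_nonneg (mul_nonneg hK hE0) hC]
  by_cases hsc : c ≤ s
  · refine (h2 s t hsc hst htb).trans ?_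
    gcongr
    nlinarith [mul_nonneg (mul_nonneg hK hE0) hC]
  push Not at htc hsc
  have r1 := h1 s c has hsc.le le_rfl
  have r2 := h2 c t le_rfl htc.le htb
  have r3 := h.dfc s c t (by linarith) hsc.le htc.le (by linarith) (y s)
  have r4 := h.lip c t (by linarith) htc.le (by linarith) (y c) (y s + ν s c (y s))
  have m1 : (c - s) ^ (3 * β) ≤ (t - s) ^ (3 * β) :=
    Real.rpow_le_rpow (by linarith) (by linarith) (by linarith)
  have m2 : (t - c) ^ (3 * β) ≤ (t - s) ^ (3 * β) :=
    Real.rpow_le_rpow (by linarith) (by linarith) (by linarith)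
  have m3 : (t - c) ^ β ≤ (b - a) ^ β :=
    Real.rpow_le_rpow (by linarith) (by linarith) (by linarith)
  have e : y t - y s - ν s t (y s) = (y t - y c - ν c t (y c)) +
      ((y c - y s - ν s c (y s)) + (ν c t (y c) - ν c t (y s + ν s c (y s)))) +
      dfct ν s c t (y s) := by
    unfold dfct; abel
  rw [e]
  rw [← sub_sub] at r4
  have r1' := r1.trans (mul_le_mul_of_nonneg_left m1 hC)
  have r2' := r2.trans (mul_le_mul_of_nonneg_left m2 hC)
  calc _ ≤ C * (t - s) ^ (3 * β) + (C * (t - s) ^ (3 * β) +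
        K * (b - a) ^ β * (C * (t - s) ^ (3 * β))) + K * (t - s) ^ (3 * β) := by
        refine norm_add₃_le.trans ?_
        refine add_le_add (add_le_add r2' ((norm_add_le _ _).trans (add_le_add r1' ?_))) r3
        refine r4.trans ?_
        gcongr
    _ = _ := by ring

lemma Dav.congr {β C a b : ℝ} {ν : ℝ → ℝ → W → W} {y y' : ℝ → W} (h : Dav β C a b ν y)
    (he : ∀ t, a ≤ t → t ≤ b → y' t = y t) : Dav β C a b ν y' := by
  intro s t h1 h2 h3
  rw [he s h1 (h2.trans h3), he t (h1.trans h2) h3]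
  exact h s t h1 h2 h3

lemma exists_global [ProperSpace W] {β K A B : ℝ} {ν : ℝ → ℝ → W → W} (h : AF β K A B ν)
    (hβ : 1 / 3 < β) (hAB : A ≤ B) (x : W) :
    ∃ (y : ℝ → W) (C : ℝ), 0 ≤ C ∧ y A = x ∧ Dav β C A B ν y := by
  obtain ⟨δ, hδ, M, hM, hloc⟩ := exists_local h hβ
  have key : ∀ n : ℕ, ∀ b, A ≤ b → b ≤ B → b ≤ A + n * δ →
      ∃ (y : ℝ → W) (C : ℝ), 0 ≤ C ∧ y A = x ∧ Dav β C A b ν y := by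
    intro n
    induction n with
    | zero =>
      intro b h1 h2 h3
      obtain ⟨y, hy, hd⟩ := hloc A b le_rfl h1 h2 (by simp at h3; linarith) x
      exact ⟨y, M, hM, hy, hd⟩
    | succ n ih =>
      intro b h1 h2 h3
      push_cast at h3
      have hn : 0 ≤ (n:ℝ) * δ := by positivity
      set c := max A (b - δ) with hc
      have hcA : A ≤ c := le_max_left _ _
      have hcb : c ≤ b := max_le h1 (by linarith)
      have hbc : b - δ ≤ c := le_max_right _ _
      obtain ⟨y₁, C, hC, hy₁, hd₁⟩ := ih c hcA (by linarith) (max_le (by linarith) (by linarith))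
      obtain ⟨y₂, hy₂, hd₂⟩ := hloc c b hcA hcb h2 (by linarith) (y₁ c)
      let y : ℝ → W := fun t => if t ≤ c then y₁ t else y₂ t
      have e1 : ∀ t, A ≤ t → t ≤ c → y t = y₁ t := fun t _ ht => if_pos ht
      have e2 : ∀ t, c ≤ t → t ≤ b → y t = y₂ t := by
        intro t ht _
        rcases ht.eq_or_lt with rfl | ht
        · rw [hy₂]; exact if_pos le_rfl
        · exact if_neg (not_le.2 ht)
      have g1 := (hd₁.congr e1).le (le_max_left C M)
      have g2 := (hd₂.congr e2).le (le_max_right C M)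
      have hCM : 0 ≤ max C M := hM.trans (le_max_right C M)
      have := dav_concat h (by linarith) le_rfl hcA hcb h2 hCM g1 g2
      refine ⟨y, _, ?_, ?_, this⟩
      · have : 0 ≤ (b - A) ^ β := Real.rpow_nonneg (by linarith) _
        have := h.K0
        positivity
      · rw [e1 A le_rfl hcA, hy₁]
  obtain ⟨n, hn⟩ := exists_nat_ge ((B - A) / δ)
  rw [div_le_iff₀ hδ] at hn
  exact key n B hAB le_rfl (by linarith)

lemma unique_step {β K A B : ℝ} {ν : ℝ → ℝ → W → W} (h : AF β K A B ν) (hβ : 1 / 3 < β)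
    {k δ₀ C : ℝ} (hk0 : 0 ≤ k) (hk1 : k ≤ 1) (hC : 0 ≤ C) (hδ : K * δ₀ ^ β ≤ k)
    {q : ℝ} (hq0 : 0 ≤ q)
    (hq : ((1:ℝ) / 2) ^ (3 * β) * (2 + 3 * k) + (2 * C + K) * δ₀ ^ (3 * β) ≤ q)
    {a b : ℝ} (hAa : A ≤ a) (hbB : b ≤ B) (hab : b - a ≤ δ₀) {y z : ℝ → W}
    (hy : Dav β C a b ν y) (hz : Dav β C a b ν z) (hyz : y a = z a) (n : ℕ) :
    ∀ s t, a ≤ s → s ≤ t → t ≤ b →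
      ‖(y t - y s - ν s t (y s)) - (z t - z s - ν s t (z s))‖ ≤
        2 * C * q ^ n * (t - s) ^ (3 * β) := by
  have hK := h.K0
  induction n with
  | zero =>
    intro s t h1 h2 h3
    have := hy s t h1 h2 h3
    have := hz s t h1 h2 h3
    refine (norm_sub_le _ _).trans ?_
    rw [pow_zero]; linarith
  | succ n ih =>
    intro s t h1 h2 h3
    set Q := 2 * C * q ^ n with hQ
    have hQ0 : 0 ≤ Q := by positivity
    set m := (s + t) / 2 with hm
    have hd : ‖y s - z s‖ ≤ Q * δ₀ ^ (3 * β) := by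
      have := ih a s le_rfl h1 (by linarith)
      rw [hyz] at this
      have e : (y s - z a - ν a s (z a)) - (z s - z a - ν a s (z a)) = y s - z s := by abel
      rw [e] at this
      refine this.trans (mul_le_mul_of_nonneg_left ?_ hQ0)
      exact Real.rpow_le_rpow (by linarith) (by linarith) (by linarith)
    have hδ0 : 0 ≤ δ₀ := by linarith
    set D := (t - s) ^ (3 * β) with hD
    set c := ((1:ℝ) / 2) ^ (3 * β) with hcdef
    have hc0 : 0 ≤ c := by positivity
    have hD0 : 0 ≤ D := Real.rpow_nonneg (by linarith) _
    have hp1 : (m - s) ^ (3 * β) = c * D := by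
      rw [hcdef, hD, ← half_rpow (by linarith)]; congr 1; rw [hm]; ring
    have hp2 : (t - m) ^ (3 * β) = c * D := by
      rw [hcdef, hD, ← half_rpow (by linarith)]; congr 1; rw [hm]; ring
    have hb : ∀ a' b', 0 ≤ b' - a' → b' - a' ≤ δ₀ → K * (b' - a') ^ β ≤ k := by
      intro a b h0 h1
      refine le_trans ?_ hδ
      have := Real.rpow_le_rpow h0 h1 (by linarith : 0 ≤ β)
      gcongr
    have i1 := ih s m h1 (by linarith) (by linarith)
    have i2 := ih m t (by linarith) (by linarith) h3
    rw [hp1] at i1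
    rw [hp2] at i2
    have ry := hy s m h1 (by linarith) (by linarith)
    rw [hp1] at ry
    set R := y m - y s - ν s m (y s) with hR
    set R' := z m - z s - ν s m (z s) with hR'
    set p := y s + ν s m (y s) with hp
    set p' := z s + ν s m (z s) with hp'
    have f4 := h.four m t (by linarith) (by linarith) (by linarith) p R p' R'
    have hpp : ‖p - p'‖ ≤ 2 * ‖y s - z s‖ := by
      have e : p - p' = (y s - z s) + (ν s m (y s) - ν s m (z s)) := by rw [hp, hp']; abel
      rw [e]
      have l1 := h.lip s m (by linarith) (by linarith) (by linarith) (y s) (z s)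
      have l2 := hb s m (by linarith) (by linarith)
      have l3 : K * (m - s) ^ β * ‖y s - z s‖ ≤ 1 * ‖y s - z s‖ := by gcongr; linarith
      refine (norm_add_le _ _).trans ?_
      linarith
    have hcD : c * D ≤ D := by
      have : c ≤ 1 := Real.rpow_le_one (by norm_num) (by norm_num) (by linarith)
      nlinarith
    set S := ‖y s - z s‖ with hS
    have hS0 : 0 ≤ S := norm_nonneg _
    have f4' : ‖(ν m t (p + R) - ν m t p) - (ν m t (p' + R') - ν m t p')‖ ≤
        k * (Q * (c * D)) + 2 * S * (C * D) := by
      refine f4.trans ?_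
      have l2 := hb m t (by linarith) (by linarith)
      calc _ ≤ k * (Q * (c * D) + (2 * S) * (C * D)) := by
            gcongr
            exact ry.trans (by gcongr)
        _ ≤ _ := by
            have : k * (2 * S * (C * D)) ≤ 1 * (2 * S * (C * D)) := by gcongr
            linarith
    have f5 := h.dfl s m t (by linarith) (by linarith) (by linarith) (by linarith) (y s) (z s)
    have ey : p + R = y m := by rw [hp, hR]; abel
    have ez : p' + R' = z m := by rw [hp', hR']; abel
    have e : (y t - y s - ν s t (y s)) - (z t - z s - ν s t (z s)) =
        ((y t - y m - ν m t (y m)) - (z t - z m - ν m t (z m))) + (R - R') +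
        ((ν m t (p + R) - ν m t p) - (ν m t (p' + R') - ν m t p')) +
        (dfct ν s m t (y s) - dfct ν s m t (z s)) := by
      rw [ey, ez]; unfold dfct; rw [← hp, ← hp', hR, hR']; abel
    rw [e]
    have hsum : ‖((y t - y m - ν m t (y m)) - (z t - z m - ν m t (z m))) + (R - R') +
        ((ν m t (p + R) - ν m t p) - (ν m t (p' + R') - ν m t p')) +
        (dfct ν s m t (y s) - dfct ν s m t (z s))‖ ≤
        Q * (c * D) + Q * (c * D) + (k * (Q * (c * D)) + 2 * S * (C * D)) + K * D * S := by
      refine norm_add₄_le.trans ?_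
      gcongr
    refine hsum.trans ?_
    have g1 : 2 * S * (C * D) + K * D * S ≤ (2 * C + K) * D * (Q * δ₀ ^ (3 * β)) := by
      have : (2 * C + K) * D * S ≤ (2 * C + K) * D * (Q * δ₀ ^ (3 * β)) := by gcongr
      linarith
    have g2 : (c * (2 + 3 * k) + (2 * C + K) * δ₀ ^ (3 * β)) * (Q * D) ≤ q * (Q * D) := by gcongr
    have g3 : 0 ≤ k * (Q * (c * D)) := by positivity
    have g4 : 2 * C * q ^ (n + 1) * D = q * (Q * D) := by rw [hQ]; ring
    rw [g4]
    nlinarith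

lemma unique_global {β K A B : ℝ} {ν : ℝ → ℝ → W → W} (h : AF β K A B ν) (hβ : 1 / 3 < β)
    {C : ℝ} (hC : 0 ≤ C) {y z : ℝ → W}
    (hy : Dav β C A B ν y) (hz : Dav β C A B ν z) (hyz : y A = z A) :
    ∀ t, A ≤ t → t ≤ B → y t = z t := by
  have hK := h.K0
  obtain ⟨k, hk0, hk1, hk⟩ := exists_kappa hβ
  obtain ⟨δ₁, hδ1, hδ1'⟩ := exists_delta (by linarith : 0 < β) K hk0
  set c := ((1:ℝ) / 2) ^ (3 * β) * (2 + 3 * k) with hc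
  have hc0 : 0 ≤ c := by positivity
  obtain ⟨δ₂, hδ2, hδ2'⟩ := exists_delta (by linarith : 0 < 3 * β) (2 * C + K)
    (by linarith : 0 < (1 - c) / 2)
  set δ := min δ₁ δ₂ with hδdef
  have hδ : 0 < δ := lt_min hδ1 hδ2
  have hA : K * δ ^ β ≤ k := by
    refine le_trans ?_ hδ1'
    gcongr
    exact min_le_left _ _
  have hB : c + (2 * C + K) * δ ^ (3 * β) ≤ (1 + c) / 2 := by
    have : (2 * C + K) * δ ^ (3 * β) ≤ (2 * C + K) * δ₂ ^ (3 * β) := by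
      gcongr
      exact min_le_right _ _
    linarith
  have loc : ∀ a b, A ≤ a → a ≤ b → b ≤ B → b - a ≤ δ → y a = z a → y b = z b := by
    intro a b h1 h2 h3 h4 h5
    have key := fun n => unique_step h hβ hk0.le hk1 hC hA (by linarith) hB h1 h3 h4
      (hy.mono h1 h3) (hz.mono h1 h3) h5 n a b le_rfl h2 le_rfl
    have e : (y b - y a - ν a b (y a)) - (z b - z a - ν a b (z a)) = y b - z b := by
      rw [h5]; abel
    simp only [e] at key
    have hlim : Tendsto (fun n : ℕ => 2 * C * ((1 + c) / 2) ^ n * (b - a) ^ (3 * β)) atTop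
        (𝓝 (2 * C * 0 * (b - a) ^ (3 * β))) :=
      ((tendsto_pow_atTop_nhds_zero_of_lt_one (by linarith) (by linarith)).const_mul
        (2 * C)).mul_const _
    have := ge_of_tendsto' hlim key
    simp at this
    exact sub_eq_zero.1 this
  have key : ∀ n : ℕ, ∀ b, A ≤ b → b ≤ B → b ≤ A + n * δ → y b = z b := by
    intro n
    induction n with
    | zero =>
      intro b h1 h2 h3
      have : b = A := by simp at h3; linarith
      rw [this, hyz]
    | succ n ih =>
      intro b h1 h2 h3
      push_cast at h3
      have hn : 0 ≤ (n:ℝ) * δ := by positivity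
      have hcA : A ≤ max A (b - δ) := le_max_left _ _
      have hcb : max A (b - δ) ≤ b := max_le h1 (by linarith)
      have hbc : b - δ ≤ max A (b - δ) := le_max_right _ _
      exact loc _ b hcA hcb h2 (by linarith)
        (ih _ hcA (by linarith) (max_le (by linarith) (by linarith)))
  intro t h1 h2
  obtain ⟨n, hn⟩ := exists_nat_ge ((t - A) / δ)
  rw [div_le_iff₀ hδ] at hn
  exact key n t h1 h2 (by linarith)

end Abstract
end SDDEP

end

noncomputable section

namespace SDDEP
open Set Filter Topology SDDE

section Calc
variable {V E G : Type*} [NormedAddCommGroup V] [NormedAddCommGroup E] [NormedAddCommGroup G]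

/-- Four-point calculus. -/
structure FP (L : ℝ) (f : V → E) : Prop where
  L0 : 0 ≤ L
  bd : ∀ z, ‖f z‖ ≤ L
  lip : ∀ z w, ‖f z - f w‖ ≤ L * ‖z - w‖
  four : ∀ z h z' h', ‖(f (z + h) - f z) - (f (z' + h') - f z')‖ ≤
    L * (‖h - h'‖ + ‖z - z'‖ * ‖h‖)

/-- Bounded Lipschitz functions. -/
structure BL (C : ℝ) (f : V → E) : Prop where
  C0 : 0 ≤ C
  bd : ∀ z, ‖f z‖ ≤ C
  lip : ∀ z w, ‖f z - f w‖ ≤ C * ‖z - w‖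

lemma FP.bl {L : ℝ} {f : V → E} (h : FP L f) : BL L f := ⟨h.L0, h.bd, h.lip⟩

lemma FP.le {L L' : ℝ} {f : V → E} (h : FP L f) (hL : L ≤ L') : FP L' f where
  L0 := h.L0.trans hL
  bd z := (h.bd z).trans hL
  lip z w := (h.lip z w).trans (by gcongr)
  four z a z' a' := (h.four z a z' a').trans (by gcongr)

lemma BL.le {L L' : ℝ} {f : V → E} (h : BL L f) (hL : L ≤ L') : BL L' f where
  C0 := h.C0.trans hL
  bd z := (h.bd z).trans hL
  lip z w := (h.lip z w).trans (by gcongr)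

lemma BL.const (c : E) : BL ‖c‖ (fun _ : V => c) where
  C0 := norm_nonneg _
  bd z := le_rfl
  lip z w := by simp; positivity

lemma FP.add {L L' : ℝ} {f g : V → E} (h : FP L f) (h' : FP L' g) :
    FP (L + L') (fun x => f x + g x) where
  L0 := add_nonneg h.L0 h'.L0
  bd z := (norm_add_le _ _).trans (add_le_add (h.bd z) (h'.bd z))
  lip z w := by
    have e : f z + g z - (f w + g w) = (f z - f w) + (g z - g w) := by abel
    rw [e, add_mul]
    exact (norm_add_le _ _).trans (add_le_add (h.lip z w) (h'.lip z w))
  four z a z' a' := by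
    have e : (f (z + a) + g (z + a) - (f z + g z)) - (f (z' + a') + g (z' + a') - (f z' + g z'))
      = ((f (z + a) - f z) - (f (z' + a') - f z')) +
        ((g (z + a) - g z) - (g (z' + a') - g z')) := by abel
    rw [e, add_mul]
    exact (norm_add_le _ _).trans (add_le_add (h.four z a z' a') (h'.four z a z' a'))

lemma BL.add {L L' : ℝ} {f g : V → E} (h : BL L f) (h' : BL L' g) :
    BL (L + L') (fun x => f x + g x) where
  C0 := add_nonneg h.C0 h'.C0
  bd z := (norm_add_le _ _).trans (add_le_add (h.bd z) (h'.bd z))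
  lip z w := by
    have e : f z + g z - (f w + g w) = (f z - f w) + (g z - g w) := by abel
    rw [e, add_mul]
    exact (norm_add_le _ _).trans (add_le_add (h.lip z w) (h'.lip z w))

/-- Post-composition with a bounded additive map. -/
lemma FP.post {L N : ℝ} {f : V → E} (h : FP L f) (Φ : E → G) (hN : 0 ≤ N)
    (hs : ∀ a b, Φ (a - b) = Φ a - Φ b) (hb : ∀ a, ‖Φ a‖ ≤ N * ‖a‖) :
    FP (N * L) (fun x => Φ (f x)) where
  L0 := mul_nonneg hN h.L0
  bd z := (hb _).trans (mul_le_mul_of_nonneg_left (h.bd z) hN)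
  lip z w := by
    rw [← hs, mul_assoc]
    exact (hb _).trans (mul_le_mul_of_nonneg_left (h.lip z w) hN)
  four z a z' a' := by
    rw [← hs, ← hs, ← hs, mul_assoc]
    exact (hb _).trans (mul_le_mul_of_nonneg_left (h.four z a z' a') hN)

lemma BL.post {L N : ℝ} {f : V → E} (h : BL L f) (Φ : E → G) (hN : 0 ≤ N)
    (hs : ∀ a b, Φ (a - b) = Φ a - Φ b) (hb : ∀ a, ‖Φ a‖ ≤ N * ‖a‖) :
    BL (N * L) (fun x => Φ (f x)) where
  C0 := mul_nonneg hN h.C0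
  bd z := (hb _).trans (mul_le_mul_of_nonneg_left (h.bd z) hN)
  lip z w := by
    rw [← hs, mul_assoc]
    exact (hb _).trans (mul_le_mul_of_nonneg_left (h.lip z w) hN)

variable {F₁ F₂ : Type*} [NormedAddCommGroup F₁] [NormedAddCommGroup F₂]

/-- Bilinear products. -/
lemma FP.bil {L L' : ℝ} {f : V → F₁} {g : V → F₂} (h : FP L f) (h' : FP L' g)
    (b : F₁ → F₂ → G) (hs1 : ∀ a a' c, b (a - a') c = b a c - b a' c)
    (hs2 : ∀ a c c', b a (c - c') = b a c - b a c') (hb : ∀ a c, ‖b a c‖ ≤ ‖a‖ * ‖c‖) :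
    FP (4 * (L * L')) (fun x => b (f x) (g x)) := by
  have hL := h.L0
  have hL' := h'.L0
  refine ⟨by positivity, ?_, ?_, ?_⟩
  · intro z
    calc _ ≤ ‖f z‖ * ‖g z‖ := hb _ _
      _ ≤ L * L' := mul_le_mul (h.bd z) (h'.bd z) (norm_nonneg _) hL
      _ ≤ _ := by nlinarith [mul_nonneg hL hL']
  · intro z w
    have e : b (f z) (g z) - b (f w) (g w) = b (f z - f w) (g z) + b (f w) (g z - g w) := by
      rw [hs1, hs2]; abel
    rw [e]
    calc _ ≤ ‖f z - f w‖ * ‖g z‖ + ‖f w‖ * ‖g z - g w‖ :=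
          (norm_add_le _ _).trans (add_le_add (hb _ _) (hb _ _))
      _ ≤ (L * ‖z - w‖) * L' + L * (L' * ‖z - w‖) := by
          gcongr
          exacts [h.lip z w, h'.bd z, h.bd w, h'.lip z w]
      _ ≤ _ := by nlinarith [mul_nonneg (mul_nonneg hL hL') (norm_nonneg (z - w))]
  · intro z a z' a'
    set p := f (z + a) - f z with hp
    set p' := f (z' + a') - f z' with hp'
    set q := g (z + a) - g z with hq
    set q' := g (z' + a') - g z' with hq'
    have e : (b (f (z + a)) (g (z + a)) - b (f z) (g z)) -
        (b (f (z' + a')) (g (z' + a')) - b (f z') (g z')) =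
        b p (g (z + a) - g (z' + a')) + b (p - p') (g (z' + a')) +
          (b (f z - f z') q + b (f z') (q - q')) := by
      simp only [hp, hp', hq, hq', hs1, hs2]; abel
    rw [e]
    set d := ‖a - a'‖
    set ρ := ‖z - z'‖
    have hd : 0 ≤ d := norm_nonneg _
    have hρ : 0 ≤ ρ := norm_nonneg _
    have ha := norm_nonneg a
    have p1 : ‖p‖ ≤ L * ‖a‖ := by simpa using h.lip (z + a) z
    have p2 : ‖p‖ ≤ 2 * L := by
      have := norm_sub_le (f (z + a)) (f z)
      linarith [h.bd (z + a), h.bd z]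
    have q1 : ‖q‖ ≤ L' * ‖a‖ := by simpa using h'.lip (z + a) z
    have g1 : ‖g (z + a) - g (z' + a')‖ ≤ L' * (ρ + d) := by
      refine (h'.lip _ _).trans ?_
      gcongr
      have : z + a - (z' + a') = (z - z') + (a - a') := by abel
      rw [this]; exact norm_add_le _ _
    have t1 : ‖b p (g (z + a) - g (z' + a'))‖ ≤ L * L' * (ρ * ‖a‖) + 2 * (L * L') * d := by
      calc _ ≤ ‖p‖ * (L' * (ρ + d)) := (hb _ _).trans (by gcongr)
        _ = ‖p‖ * (L' * ρ) + ‖p‖ * (L' * d) := by ring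
        _ ≤ (L * ‖a‖) * (L' * ρ) + (2 * L) * (L' * d) := by gcongr
        _ = _ := by ring
    have t2 : ‖b (p - p') (g (z' + a'))‖ ≤ (L * (d + ρ * ‖a‖)) * L' :=
      (hb _ _).trans (mul_le_mul (h.four z a z' a') (h'.bd _) (norm_nonneg _) (by positivity))
    have t3 : ‖b (f z - f z') q‖ ≤ (L * ρ) * (L' * ‖a‖) :=
      (hb _ _).trans (mul_le_mul (h.lip _ _) q1 (norm_nonneg _) (by positivity))
    have t4 : ‖b (f z') (q - q')‖ ≤ L * (L' * (d + ρ * ‖a‖)) :=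
      (hb _ _).trans (mul_le_mul (h.bd _) (h'.four z a z' a') (norm_nonneg _) hL)
    have hsum := (norm_add_le _ _).trans (add_le_add ((norm_add_le _ _).trans (add_le_add t1 t2))
      ((norm_add_le _ _).trans (add_le_add t3 t4)))
    refine hsum.trans (le_of_eq ?_)
    ring

lemma BL.bil {L L' : ℝ} {f : V → F₁} {g : V → F₂} (h : BL L f) (h' : BL L' g)
    (b : F₁ → F₂ → G) (hs1 : ∀ a a' c, b (a - a') c = b a c - b a' c)
    (hs2 : ∀ a c c', b a (c - c') = b a c - b a c') (hb : ∀ a c, ‖b a c‖ ≤ ‖a‖ * ‖c‖) :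
    BL (2 * (L * L')) (fun x => b (f x) (g x)) := by
  have hL := h.C0
  have hL' := h'.C0
  refine ⟨by positivity, ?_, ?_⟩
  · intro z
    calc _ ≤ ‖f z‖ * ‖g z‖ := hb _ _
      _ ≤ L * L' := mul_le_mul (h.bd z) (h'.bd z) (norm_nonneg _) hL
      _ ≤ _ := by nlinarith [mul_nonneg hL hL']
  · intro z w
    have e : b (f z) (g z) - b (f w) (g w) = b (f z - f w) (g z) + b (f w) (g z - g w) := by
      rw [hs1, hs2]; abel
    rw [e]
    calc _ ≤ ‖f z - f w‖ * ‖g z‖ + ‖f w‖ * ‖g z - g w‖ :=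
          (norm_add_le _ _).trans (add_le_add (hb _ _) (hb _ _))
      _ ≤ (L * ‖z - w‖) * L' + L * (L' * ‖z - w‖) := by
          gcongr
          exacts [h.lip z w, h'.bd z, h.bd w, h'.lip z w]
      _ = _ := by ring

/-- Slices. -/
lemma FP.slice {L : ℝ} {V' : Type*} [NormedAddCommGroup V'] {f : V × V' → E} (h : FP L f)
    (e : V') : FP L (fun x => f (x, e)) where
  L0 := h.L0
  bd z := h.bd _
  lip z w := by simpa [Prod.norm_def] using h.lip (z, e) (w, e)
  four z a z' a' := by simpa [Prod.norm_def] using h.four (z, e) (a, 0) (z', e) (a', 0)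

/-- Increment of a four-point function along a bounded Lipschitz displacement. -/
lemma FP.incr {L C : ℝ} {V' : Type*} [NormedAddCommGroup V'] {f : V' → E} (h : FP L f)
    {ζ η : V → V'} (hζ : ∀ x x', ‖ζ x - ζ x'‖ ≤ ‖x - x'‖) (hη : BL C η) :
    BL (2 * (L * C)) (fun x => f (ζ x + η x) - f (ζ x)) := by
  have hL := h.L0
  have hC := hη.C0
  refine ⟨by positivity, ?_, ?_⟩
  · intro x
    have := h.lip (ζ x + η x) (ζ x)
    rw [add_sub_cancel_left] at this
    refine this.trans ?_
    have := mul_le_mul_of_nonneg_left (hη.bd x) hL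
    nlinarith [mul_nonneg hL hC]
  · intro x x'
    refine (h.four (ζ x) (η x) (ζ x') (η x')).trans ?_
    have h1 := hη.lip x x'
    have h2 := hη.bd x
    have h3 := hζ x x'
    calc _ ≤ L * (C * ‖x - x'‖ + ‖x - x'‖ * C) := by gcongr
      _ = _ := by ring

end Calc

section Smooth
variable {V E : Type*} [NormedAddCommGroup V] [NormedSpace ℝ V]
  [NormedAddCommGroup E] [NormedSpace ℝ E]

lemma fp_of_diff {L : ℝ} {f : V → E} (hf : Differentiable ℝ f) (h0 : ∀ z, ‖f z‖ ≤ L)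
    (h1 : ∀ z, ‖fderiv ℝ f z‖ ≤ L)
    (h2 : ∀ z w, ‖fderiv ℝ f z - fderiv ℝ f w‖ ≤ L * ‖z - w‖) : FP L f := by
  have hL : 0 ≤ L := (norm_nonneg _).trans (h0 0)
  have lip : ∀ z w, ‖f z - f w‖ ≤ L * ‖z - w‖ := fun z w =>
    Convex.norm_image_sub_le_of_norm_fderiv_le (fun x _ => hf x) (fun x _ => h1 x)
      convex_univ (mem_univ w) (mem_univ z)
  refine ⟨hL, h0, lip, ?_⟩
  intro z h z' h'
  have a1 : ‖(f (z + h) - f z) - (f (z' + h) - f z')‖ ≤ (L * ‖h‖) * ‖z - z'‖ := by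
    refine Convex.norm_image_sub_le_of_norm_hasFDerivWithin_le
      (f := fun w => f (w + h) - f w) (f' := fun w => fderiv ℝ f (w + h) - fderiv ℝ f w)
      (s := univ) ?_ ?_ convex_univ (mem_univ z') (mem_univ z)
    · intro x _
      have i1 : HasFDerivAt (fun w => f (w + h)) (fderiv ℝ f (x + h)) x := by
        simpa [Function.comp_def] using
          (hf (x + h)).hasFDerivAt.comp x ((hasFDerivAt_id x).add_const h)
      exact (i1.sub (hf x).hasFDerivAt).hasFDerivWithinAt
    · intro x _
      simpa using h2 (x + h) x
  have a2 := lip (z' + h) (z' + h')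
  have e : (f (z + h) - f z) - (f (z' + h') - f z') =
      ((f (z + h) - f z) - (f (z' + h) - f z')) + (f (z' + h) - f (z' + h')) := by abel
  rw [e]
  rw [add_sub_add_left_eq_sub] at a2
  refine (norm_add_le _ _).trans ((add_le_add a1 a2).trans (le_of_eq ?_))
  ring

/-- Taylor remainder. -/
lemma taylor_four {L : ℝ} {f : V → E} (hf : Differentiable ℝ f) (h : FP L (fderiv ℝ f))
    (z h₁ z' h₂ : V) :
    ‖(f (z + h₁) - f z - fderiv ℝ f z h₁) - (f (z' + h₂) - f z' - fderiv ℝ f z' h₂)‖ ≤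
      L * (‖h₁ - h₂‖ * (‖h₁‖ + ‖h₂‖) + ‖z - z'‖ * ‖h₁‖ ^ 2) := by
  have hL := h.L0
  let ψ : ℝ → E := fun l => (f (z + l • h₁) - f z - l • fderiv ℝ f z h₁) -
    (f (z' + l • h₂) - f z' - l • fderiv ℝ f z' h₂)
  let ψ' : ℝ → E := fun l => (fderiv ℝ f (z + l • h₁) h₁ - fderiv ℝ f z h₁) -
    (fderiv ℝ f (z' + l • h₂) h₂ - fderiv ℝ f z' h₂)
  have hder1 : ∀ (z h : V) (l : ℝ), HasDerivAt (fun l : ℝ => f (z + l • h) - f z -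
      l • fderiv ℝ f z h) (fderiv ℝ f (z + l • h) h - fderiv ℝ f z h) l := by
    intro z h l
    have i1 : HasDerivAt (fun l : ℝ => z + l • h) h l := by
      simpa using ((hasDerivAt_id l).smul_const h).const_add z
    have i2 := (hf (z + l • h)).hasFDerivAt.comp_hasDerivAt l i1
    have i3 : HasDerivAt (fun l : ℝ => l • fderiv ℝ f z h) (fderiv ℝ f z h) l := by
      simpa using (hasDerivAt_id l).smul_const (fderiv ℝ f z h)
    exact (i2.sub_const (f z)).sub i3
  have hder : ∀ l ∈ Icc (0:ℝ) 1, HasDerivWithinAt ψ (ψ' l) (Icc 0 1) l := fun l _ =>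
    ((hder1 z h₁ l).sub (hder1 z' h₂ l)).hasDerivWithinAt
  have hb : ∀ l ∈ Ico (0:ℝ) 1, ‖ψ' l‖ ≤
      L * (‖h₁ - h₂‖ * (‖h₁‖ + ‖h₂‖) + ‖z - z'‖ * ‖h₁‖ ^ 2) := by
    intro l hl
    set Δ := fderiv ℝ f (z + l • h₁) - fderiv ℝ f z with hΔ
    set Δ' := fderiv ℝ f (z' + l • h₂) - fderiv ℝ f z' with hΔ'
    have e : ψ' l = (Δ - Δ') h₁ + Δ' (h₁ - h₂) := by
      simp only [ψ', hΔ, hΔ', sub_apply, map_sub]; abel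
    have l0 := hl.1
    have l1 := hl.2.le
    have hn : ∀ v : V, ‖l • v‖ ≤ ‖v‖ := by
      intro v
      rw [norm_smul, Real.norm_of_nonneg l0]
      exact mul_le_of_le_one_left (norm_nonneg _) l1
    have b1 : ‖Δ - Δ'‖ ≤ L * (‖h₁ - h₂‖ + ‖z - z'‖ * ‖h₁‖) := by
      refine (h.four _ _ _ _).trans ?_
      rw [← smul_sub]
      gcongr
      · exact hn _
      · exact hn _
    have b2 : ‖Δ'‖ ≤ L * ‖h₂‖ := by
      refine (h.lip _ _).trans ?_
      rw [add_sub_cancel_left]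
      gcongr
      exact hn _
    rw [e]
    calc _ ≤ ‖Δ - Δ'‖ * ‖h₁‖ + ‖Δ'‖ * ‖h₁ - h₂‖ :=
          (norm_add_le _ _).trans (add_le_add (ContinuousLinearMap.le_opNorm _ _)
            (ContinuousLinearMap.le_opNorm _ _))
      _ ≤ L * (‖h₁ - h₂‖ + ‖z - z'‖ * ‖h₁‖) * ‖h₁‖ + L * ‖h₂‖ * ‖h₁ - h₂‖ := by gcongr
      _ = _ := by ring
  have := norm_image_sub_le_of_norm_deriv_le_segment_01' hder hb
  simpa [ψ] using this

lemma taylor_bl {L C : ℝ} {V₀ : Type*} [NormedAddCommGroup V₀] {f : V → E}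
    (hf : Differentiable ℝ f) (h : FP L (fderiv ℝ f))
    {ζ η : V₀ → V} (hζ : ∀ x x', ‖ζ x - ζ x'‖ ≤ ‖x - x'‖) (hη : BL C η) :
    BL (3 * (L * C ^ 2))
      (fun x => f (ζ x + η x) - f (ζ x) - fderiv ℝ f (ζ x) (η x)) := by
  have hL := h.L0
  have hC := hη.C0
  refine ⟨by positivity, ?_, ?_⟩
  · intro x
    have := taylor_four hf h (ζ x) (η x) (ζ x) 0
    simp only [add_zero, sub_self, map_zero, sub_zero, norm_zero, zero_mul] at this
    refine this.trans ?_
    have := hη.bd x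
    calc _ ≤ L * (C * C) := by gcongr
      _ ≤ _ := by nlinarith [mul_nonneg hL (mul_nonneg hC hC)]
  · intro x x'
    refine (taylor_four hf h (ζ x) (η x) (ζ x') (η x')).trans ?_
    have h1 := hη.lip x x'
    have h2 := hη.bd x
    have h2' := hη.bd x'
    have h3 := hζ x x'
    calc _ ≤ L * (C * ‖x - x'‖ * (C + C) + ‖x - x'‖ * C ^ 2) := by gcongr
      _ = _ := by ring

lemma lip_of_iter {L : ℝ} {g : V → E} (hd : Differentiable ℝ g)
    (h : ∀ z, ‖iteratedFDeriv ℝ 1 g z‖ ≤ L) : ∀ z w, ‖g z - g w‖ ≤ L * ‖z - w‖ := by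
  have h' : ∀ z, ‖fderiv ℝ g z‖ ≤ L := fun z => by
    have := h z
    rwa [norm_iteratedFDeriv_one] at this
  exact fun z w => Convex.norm_image_sub_le_of_norm_fderiv_le (fun x _ => hd x)
      (fun x _ => h' x) convex_univ (mem_univ w) (mem_univ z)

lemma fp_of_cn {f : V → E} (h : CnBounded 3 f) :
    ∃ L : ℝ, Differentiable ℝ f ∧ FP L f ∧ FP L (fderiv ℝ f) := by
  obtain ⟨hc, hb⟩ := h
  obtain ⟨C0, h0⟩ := hb 0 (by norm_num)
  obtain ⟨C1, h1⟩ := hb 1 (by norm_num)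
  obtain ⟨C2, h2⟩ := hb 2 (by norm_num)
  obtain ⟨C3, h3⟩ := hb 3 (by norm_num)
  set L := max (max C0 C1) (max C2 C3)
  have hd : Differentiable ℝ f := hc.differentiable (by norm_num)
  have hc1 : ContDiff ℝ 2 (fderiv ℝ f) := hc.fderiv_right (by norm_num)
  have hc2 : ContDiff ℝ 1 (fderiv ℝ (fderiv ℝ f)) := hc1.fderiv_right (by norm_num)
  have hd1 : Differentiable ℝ (fderiv ℝ f) := hc1.differentiable (by norm_num)
  have hd2 : Differentiable ℝ (fderiv ℝ (fderiv ℝ f)) := hc2.differentiable (by norm_num)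
  have b0 : ∀ z, ‖f z‖ ≤ L := fun z => by
    have := h0 z
    rw [norm_iteratedFDeriv_zero] at this
    exact this.trans ((le_max_left _ _).trans (le_max_left _ _))
  have b1 : ∀ z, ‖fderiv ℝ f z‖ ≤ L := fun z => by
    have := h1 z
    rw [norm_iteratedFDeriv_one] at this
    exact this.trans ((le_max_right _ _).trans (le_max_left _ _))
  have b2 : ∀ z, ‖fderiv ℝ (fderiv ℝ f) z‖ ≤ L := fun z => by
    have := h2 z
    rw [← norm_iteratedFDeriv_fderiv, norm_iteratedFDeriv_one] at this
    exact this.trans ((le_max_left _ _).trans (le_max_right _ _))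
  have b3 : ∀ z, ‖iteratedFDeriv ℝ 1 (fderiv ℝ (fderiv ℝ f)) z‖ ≤ L := fun z => by
    have := h3 z
    rw [← norm_iteratedFDeriv_fderiv, ← norm_iteratedFDeriv_fderiv] at this
    exact this.trans ((le_max_right _ _).trans (le_max_right _ _))
  refine ⟨L, hd, fp_of_diff hd b0 b1 ?_, fp_of_diff hd1 b1 b2 ?_⟩
  · exact fun z w => Convex.norm_image_sub_le_of_norm_fderiv_le (fun x _ => hd1 x)
      (fun x _ => b2 x) convex_univ (mem_univ w) (mem_univ z)
  · exact lip_of_iter hd2 b3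

end Smooth
end SDDEP

end

noncomputable section

namespace SDDEP
open Set Filter Topology SDDE

section Apply2
variable {E : Type*} [NormedAddCommGroup E] [NormedSpace ℝ E] {d : ℕ}

lemma apply2_sub_left (a b : (Fin d → ℝ) →L[ℝ] ((Fin d → ℝ) →L[ℝ] E)) (M : Fin d → Fin d → ℝ) :
    apply2 (a - b) M = apply2 a M - apply2 b M := by
  simp [apply2, smul_sub, Finset.sum_sub_distrib]

lemma apply2_add_left (a b : (Fin d → ℝ) →L[ℝ] ((Fin d → ℝ) →L[ℝ] E)) (M : Fin d → Fin d → ℝ) :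
    apply2 (a + b) M = apply2 a M + apply2 b M := by
  simp [apply2, smul_add, Finset.sum_add_distrib]

lemma apply2_add_right (a : (Fin d → ℝ) →L[ℝ] ((Fin d → ℝ) →L[ℝ] E)) (M N : Fin d → Fin d → ℝ) :
    apply2 a (M + N) = apply2 a M + apply2 a N := by
  simp [apply2, add_smul, Finset.sum_add_distrib]

lemma apply2_zero_right (a : (Fin d → ℝ) →L[ℝ] ((Fin d → ℝ) →L[ℝ] E)) :
    apply2 a (0 : Fin d → Fin d → ℝ) = 0 := by
  simp [apply2]

lemma apply2_tensor (a : (Fin d → ℝ) →L[ℝ] ((Fin d → ℝ) →L[ℝ] E)) (p q : Fin d → ℝ) :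
    apply2 a (fun i j => p i * q j) = a p q := by
  have hp : ∀ p : Fin d → ℝ, p = ∑ i, p i • (Pi.single i (1:ℝ) : Fin d → ℝ) := by
    intro p
    ext j
    simp [Finset.sum_apply, Pi.single_apply]
  conv_rhs => rw [hp p, hp q]
  simp only [apply2, map_sum, map_smul, sum_apply, smul_apply,
    Finset.smul_sum, smul_smul]
  rw [Finset.sum_comm]
  refine Finset.sum_congr rfl fun i _ => Finset.sum_congr rfl fun j _ => ?_
  rw [mul_comm]

lemma apply2_norm (a : (Fin d → ℝ) →L[ℝ] ((Fin d → ℝ) →L[ℝ] E)) (M : Fin d → Fin d → ℝ) :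
    ‖apply2 a M‖ ≤ ((d : ℝ) ^ 2 * ‖M‖) * ‖a‖ := by
  have h1 : ∀ i : Fin d, ‖(Pi.single i (1:ℝ) : Fin d → ℝ)‖ ≤ 1 := by
    intro i
    rw [Pi.norm_single]; simp
  have h2 : ∀ i j : Fin d, ‖M i j • a (Pi.single i 1) (Pi.single j 1)‖ ≤ ‖M‖ * ‖a‖ := by
    intro i j
    rw [norm_smul]
    have e1 : ‖M i j‖ ≤ ‖M‖ := (norm_le_pi_norm (M i) j).trans (norm_le_pi_norm M i)
    have e2 : ‖a (Pi.single i 1) (Pi.single j 1)‖ ≤ ‖a‖ := by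
      calc _ ≤ ‖a (Pi.single i 1)‖ * ‖(Pi.single j (1:ℝ) : Fin d → ℝ)‖ :=
            ContinuousLinearMap.le_opNorm _ _
        _ ≤ (‖a‖ * ‖(Pi.single i (1:ℝ) : Fin d → ℝ)‖) * 1 := by
            gcongr
            exacts [ContinuousLinearMap.le_opNorm _ _, h1 j]
        _ ≤ (‖a‖ * 1) * 1 := by gcongr; exact h1 i
        _ = _ := by ring
    gcongr
  calc _ ≤ ∑ i : Fin d, ∑ j : Fin d, ‖M‖ * ‖a‖ :=
        (norm_sum_le _ _).trans (Finset.sum_le_sum fun i _ =>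
          (norm_sum_le _ _).trans (Finset.sum_le_sum fun j _ => h2 i j))
    _ = _ := by simp; ring

end Apply2

section Step
variable {W : Type*} [NormedAddCommGroup W] [NormedSpace ℝ W] {d : ℕ}

/-- The coefficient `σ_x σ`. -/
def cf (σ : W × W → (Fin d → ℝ) →L[ℝ] W) (z : W × W) :
    (Fin d → ℝ) →L[ℝ] ((Fin d → ℝ) →L[ℝ] W) := (sigmaX σ z).comp (σ z)

/-- second order part of one step -/
def step2 (σ : W × W → (Fin d → ℝ) →L[ℝ] W) (c : W) (c' : (Fin d → ℝ) →L[ℝ] W)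
    (M N : Fin d → Fin d → ℝ) (x : W) : W :=
  apply2 (cf σ (x, c)) M + apply2 ((sigmaY σ (x, c)).comp c') N

/-- one step of the scheme -/
def step (σ : W × W → (Fin d → ℝ) →L[ℝ] W) (c : W) (c' : (Fin d → ℝ) →L[ℝ] W)
    (a : Fin d → ℝ) (M N : Fin d → Fin d → ℝ) (x : W) : W :=
  σ (x, c) a + step2 σ c c' M N x

lemma fp_sigmaX {K : ℝ} {σ : W × W → (Fin d → ℝ) →L[ℝ] W} (h : FP K (fderiv ℝ σ)) :
    FP K (sigmaX σ) := by
  have := h.post (N := 1) (fun l : W × W →L[ℝ] ((Fin d → ℝ) →L[ℝ] W) =>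
    l.comp (ContinuousLinearMap.inl ℝ W W)) zero_le_one
    (fun a b => by simp [ContinuousLinearMap.sub_comp])
    (fun a => by
      refine (ContinuousLinearMap.opNorm_comp_le _ _).trans ?_
      rw [one_mul]
      exact mul_le_of_le_one_right (norm_nonneg _) (ContinuousLinearMap.norm_inl_le_one ℝ W W))
  rw [one_mul] at this
  exact this

lemma fp_sigmaY {K : ℝ} {σ : W × W → (Fin d → ℝ) →L[ℝ] W} (h : FP K (fderiv ℝ σ)) :
    FP K (sigmaY σ) := by
  have := h.post (N := 1) (fun l : W × W →L[ℝ] ((Fin d → ℝ) →L[ℝ] W) =>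
    l.comp (ContinuousLinearMap.inr ℝ W W)) zero_le_one
    (fun a b => by simp [ContinuousLinearMap.sub_comp])
    (fun a => by
      refine (ContinuousLinearMap.opNorm_comp_le _ _).trans ?_
      rw [one_mul]
      exact mul_le_of_le_one_right (norm_nonneg _) (ContinuousLinearMap.norm_inr_le_one ℝ W W))
  rw [one_mul] at this
  exact this

lemma fp_cf {K : ℝ} {σ : W × W → (Fin d → ℝ) →L[ℝ] W} (h0 : FP K σ) (h : FP K (fderiv ℝ σ)) :
    FP (4 * (K * K)) (cf σ) :=
  (fp_sigmaX h).bil h0 (fun a b => a.comp b) (fun a b c => by simp [ContinuousLinearMap.sub_comp])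
    (fun a b c => by simp [ContinuousLinearMap.comp_sub])
    (fun a b => ContinuousLinearMap.opNorm_comp_le _ _)

lemma comp_post_bound {V₁ V₂ V₃ : Type*} [NormedAddCommGroup V₁] [NormedSpace ℝ V₁]
    [NormedAddCommGroup V₂] [NormedSpace ℝ V₂] [NormedAddCommGroup V₃] [NormedSpace ℝ V₃]
    {C : ℝ} (c : V₁ →L[ℝ] V₂) (hc : ‖c‖ ≤ C) (a : V₂ →L[ℝ] V₃) : ‖a.comp c‖ ≤ C * ‖a‖ := by
  refine (ContinuousLinearMap.opNorm_comp_le _ _).trans ?_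
  rw [mul_comm]; gcongr

lemma apply2_bound {K e : ℝ} (hd : (d : ℝ) ^ 2 ≤ K) (hK : 1 ≤ K) {M : Fin d → Fin d → ℝ}
    (hM : ‖M‖ ≤ K * e ^ 2) (a : (Fin d → ℝ) →L[ℝ] ((Fin d → ℝ) →L[ℝ] W)) :
    ‖apply2 a M‖ ≤ (K ^ 2 * e ^ 2) * ‖a‖ := by
  refine (apply2_norm a M).trans ?_
  have : (d : ℝ) ^ 2 * ‖M‖ ≤ K * (K * e ^ 2) := by gcongr
  calc _ ≤ (K * (K * e ^ 2)) * ‖a‖ := by gcongr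
    _ = _ := by ring

variable {K e : ℝ} {σ : W × W → (Fin d → ℝ) →L[ℝ] W}

lemma fp_step2 (h0 : FP K σ) (h1 : FP K (fderiv ℝ σ)) (hd : (d : ℝ) ^ 2 ≤ K) (hK : 1 ≤ K)
    {c : W} {c' : (Fin d → ℝ) →L[ℝ] W} {M N : Fin d → Fin d → ℝ} (hc' : ‖c'‖ ≤ K)
    (hM : ‖M‖ ≤ K * e ^ 2) (hN : ‖N‖ ≤ K * e ^ 2) : FP (5 * K ^ 4 * e ^ 2) (step2 σ c c' M N) := by
  have i1 := ((fp_cf h0 h1).slice c).post (fun a => apply2 a M) (N := K ^ 2 * e ^ 2) (by positivity)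
    (fun a b => apply2_sub_left a b M) (apply2_bound hd hK hM)
  have i2 := ((((fp_sigmaY h1).slice c).post (N := K) (fun a => a.comp c') (by positivity)
    (fun a b => by simp [ContinuousLinearMap.sub_comp]) (comp_post_bound c' hc'))).post
      (fun a => apply2 a N) (N := K ^ 2 * e ^ 2) (by positivity)
    (fun a b => apply2_sub_left a b N) (apply2_bound hd hK hN)
  exact (i1.add i2).le (le_of_eq (by ring))

lemma fp_step (h0 : FP K σ) (h1 : FP K (fderiv ℝ σ)) (hd : (d : ℝ) ^ 2 ≤ K) (hK : 1 ≤ K)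
    {c : W} {c' : (Fin d → ℝ) →L[ℝ] W} {a : Fin d → ℝ} {M N : Fin d → Fin d → ℝ} (he : 0 ≤ e)
    (heK : e ≤ K) (ha : ‖a‖ ≤ K * e) (hc' : ‖c'‖ ≤ K)
    (hM : ‖M‖ ≤ K * e ^ 2) (hN : ‖N‖ ≤ K * e ^ 2) : FP (6 * K ^ 5 * e) (step σ c c' a M N) := by
  have i1 := (h0.slice c).post (fun l => l a) (N := K * e) (by positivity)
    (fun a b => by simp) (fun l => (l.le_opNorm a).trans (by rw [mul_comm]; gcongr))
  refine (i1.add (fp_step2 h0 h1 hd hK hc' hM hN)).le ?_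
  have h2 : K ^ 2 ≤ K ^ 5 := pow_le_pow_right₀ hK (by norm_num)
  calc _ = (K ^ 2 + 5 * K ^ 4 * e) * e := by ring
    _ ≤ (K ^ 5 + 5 * K ^ 4 * K) * e := by gcongr
    _ = _ := by ring

lemma BL.pair {V E F : Type*} [NormedAddCommGroup V] [NormedAddCommGroup E] [NormedAddCommGroup F]
    {C : ℝ} {f : V → E} (h : BL C f) {c : F} (hc : ‖c‖ ≤ C) : BL C (fun x => (f x, c)) where
  C0 := h.C0
  bd z := by
    rw [Prod.norm_def]; exact max_le (h.bd z) hc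
  lip z w := by
    have : ‖(f z, c) - (f w, c)‖ = ‖f z - f w‖ := by simp [Prod.norm_def]
    rw [this]; exact h.lip z w

/-- The defect of one step. -/
lemma bl_defect (hdf : Differentiable ℝ σ) (h0 : FP K σ) (h1 : FP K (fderiv ℝ σ))
    (hd : (d : ℝ) ^ 2 ≤ K) (hK : 1 ≤ K)
    {c₁ c₂ : W} {c₁' c₂' : (Fin d → ℝ) →L[ℝ] W} {a b p : Fin d → ℝ}
    {M₁ N₁ M₂ N₂ M N : Fin d → Fin d → ℝ} (he : 0 ≤ e)
    (heK : e ≤ K) (ha : ‖a‖ ≤ K * e) (hb : ‖b‖ ≤ K * e) (hp : ‖p‖ ≤ K * e)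
    (hc₁ : ‖c₁'‖ ≤ K) (hc₂ : ‖c₂'‖ ≤ K) (hcc : ‖c₂' - c₁'‖ ≤ K * e)
    (hc : ‖c₂ - c₁ - c₁' p‖ ≤ K * e ^ 2)
    (hM₁ : ‖M₁‖ ≤ K * e ^ 2) (hN₁ : ‖N₁‖ ≤ K * e ^ 2)
    (hM₂ : ‖M₂‖ ≤ K * e ^ 2) (hN₂ : ‖N₂‖ ≤ K * e ^ 2)
    (hM : M = M₁ + M₂ + fun i j => a i * b j) (hN : N = N₁ + N₂ + fun i j => p i * b j) :
    BL (179 * K ^ 12 * e ^ 3) (fun x => step σ c₁ c₁' a M₁ N₁ x +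
      step σ c₂ c₂' b M₂ N₂ (x + step σ c₁ c₁' a M₁ N₁ x) - step σ c₁ c₁' (a + b) M N x) := by
  have K0 : 0 ≤ K := by linarith
  have s1 := fp_step (c := c₁) h0 h1 hd hK he heK ha hc₁ hM₁ hN₁
  have s2 := fp_step2 (c := c₁) h0 h1 hd hK hc₁ hM₁ hN₁
  have hcs : ‖c₂ - c₁‖ ≤ 6 * K ^ 5 * e := by
    have e1 : c₂ - c₁ = (c₂ - c₁ - c₁' p) + c₁' p := by abel
    rw [e1]
    have h2 : K ^ 2 ≤ K ^ 5 := pow_le_pow_right₀ hK (by norm_num)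
    calc _ ≤ K * e ^ 2 + ‖c₁'‖ * ‖p‖ :=
          (norm_add_le _ _).trans (add_le_add hc (ContinuousLinearMap.le_opNorm _ _))
      _ ≤ K * e ^ 2 + K * (K * e) := by gcongr
      _ = (K * e + K ^ 2) * e := by ring
      _ ≤ (K * K + K ^ 2) * e := by gcongr
      _ = 2 * K ^ 2 * e := by ring
      _ ≤ 6 * K ^ 5 * e := by gcongr; norm_num
  have hζ : ∀ x x' : W, ‖((x, c₁) : W × W) - (x', c₁)‖ ≤ ‖x - x'‖ := by
    intro x x'; simp [Prod.norm_def]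
  set H : W → W × W := fun x => (step σ c₁ c₁' a M₁ N₁ x, c₂ - c₁) with hH
  have bH : BL (6 * K ^ 5 * e) H := s1.bl.pair hcs
  set Q : W → W × W := fun x => (step2 σ c₁ c₁' M₁ N₁ x, c₂ - c₁ - c₁' p) with hQ
  have bQ : BL (5 * K ^ 4 * e ^ 2) Q := s2.bl.pair (hc.trans (by
    have h2 : K ^ 1 ≤ K ^ 4 := pow_le_pow_right₀ hK (by norm_num)
    rw [pow_one] at h2
    gcongr
    nlinarith))
  have t1 := taylor_bl hdf h1 hζ bH
  have t2 := (h1.slice c₁).bl.bil bQ (fun l v => l v) (fun a b c => by simp)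
    (fun a b c => by simp) (fun a b => a.le_opNorm b)
  have t3 := (t1.add t2).post (fun l => l b) (N := K * e) (by positivity)
    (fun a b => by simp) (fun l => (l.le_opNorm b).trans (by rw [mul_comm]; gcongr))
  have t4 := ((fp_cf h0 h1).incr hζ bH).post (fun l => apply2 l M₂) (N := K ^ 2 * e ^ 2)
    (by positivity) (fun a b => apply2_sub_left a b M₂) (apply2_bound hd hK hM₂)
  have t5 := ((fp_sigmaY h1).incr hζ bH).post (N := K) (fun a => a.comp c₂') (by positivity)
    (fun a b => by simp [ContinuousLinearMap.sub_comp]) (comp_post_bound c₂' hc₂)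
  have t6 := ((fp_sigmaY h1).slice c₁).bl.post (N := K * e) (fun a => a.comp (c₂' - c₁'))
    (by positivity)
    (fun a b => ContinuousLinearMap.sub_comp a b _) (comp_post_bound (c₂' - c₁') hcc)
  have t7 := (t5.add t6).post (fun l => apply2 l N₂) (N := K ^ 2 * e ^ 2)
    (by positivity) (fun a b => apply2_sub_left a b N₂) (apply2_bound hd hK hN₂)
  have tt := (t3.add (t4.add t7)).le (L' := 179 * K ^ 12 * e ^ 3) (by
    have p5 : K ^ 6 ≤ K ^ 12 := pow_le_pow_right₀ hK (by norm_num)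
    have p9 : K ^ 9 ≤ K ^ 12 := pow_le_pow_right₀ hK (by norm_num)
    have p4 : K ^ 4 ≤ K ^ 12 := pow_le_pow_right₀ hK (by norm_num)
    calc _ = (108 * K ^ 12 + 10 * K ^ 6 + 48 * K ^ 9 + 12 * K ^ 9 + K ^ 4) * e ^ 3 := by ring
      _ ≤ (179 * K ^ 12) * e ^ 3 := by gcongr; linarith
      _ = _ := by ring)
  convert tt using 1
  funext x
  have hz : ((x, c₁) : W × W) + H x = (x + step σ c₁ c₁' a M₁ N₁ x, c₂) := by
    simp [hH]
  have hHQ : H x - Q x = (σ (x, c₁) a, 0) + (0, c₁' p) := by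
    simp [hH, hQ, step]
  have hD : fderiv ℝ σ (x, c₁) (Q x) = fderiv ℝ σ (x, c₁) (H x) -
      sigmaX σ (x, c₁) (σ (x, c₁) a) - sigmaY σ (x, c₁) (c₁' p) := by
    have : Q x = H x - ((σ (x, c₁) a, 0) + (0, c₁' p)) := by rw [← hHQ]; abel
    rw [this, map_sub, map_add]
    simp only [sigmaX, sigmaY, ContinuousLinearMap.comp_apply, ContinuousLinearMap.inl_apply,
      ContinuousLinearMap.inr_apply]
    abel
  rw [hz, hD]
  set y := x + step σ c₁ c₁' a M₁ N₁ x with hy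
  subst hM hN
  simp only [step, step2, apply2_add_right, apply2_tensor, map_add, apply2_sub_left,
    apply2_add_left, ContinuousLinearMap.sub_comp, ContinuousLinearMap.comp_sub, add_apply,
    sub_apply]
  simp only [cf, ContinuousLinearMap.comp_apply]
  abel


variable {r γ : ℝ}

/-- The approximate flow. -/
def nu (RP : DelayedRoughPath d r γ) (σ : W × W → (Fin d → ℝ) →L[ℝ] W) (η : ℝ → W)
    (η' : ℝ → (Fin d → ℝ) →L[ℝ] W) (s t : ℝ) (x : W) : W :=
  step σ (η s) (η' s) (RP.X t - RP.X s) (RP.XX s t) (RP.XXd s t) x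

/-- Bounds on the data on the interval `[A,B]`. -/
structure Dat (RP : DelayedRoughPath d r γ) (σ : W × W → (Fin d → ℝ) →L[ℝ] W) (β K A B : ℝ)
    (η : ℝ → W) (η' : ℝ → (Fin d → ℝ) →L[ℝ] W) : Prop where
  hK : 1 ≤ K
  dif : Differentiable ℝ σ
  h0 : FP K σ
  h1 : FP K (fderiv ℝ σ)
  hd : (d : ℝ) ^ 2 ≤ K
  ht : ∀ s t, A ≤ s → s ≤ t → t ≤ B → (t - s) ^ β ≤ K
  hX : ∀ s t, A ≤ s → s ≤ t → t ≤ B → ‖RP.X t - RP.X s‖ ≤ K * (t - s) ^ β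
  hXr : ∀ s t, A ≤ s → s ≤ t → t ≤ B → ‖RP.X (t - r) - RP.X (s - r)‖ ≤ K * (t - s) ^ β
  hXX : ∀ s t, A ≤ s → s ≤ t → t ≤ B → ‖RP.XX s t‖ ≤ K * ((t - s) ^ β) ^ 2
  hXXd : ∀ s t, A ≤ s → s ≤ t → t ≤ B → ‖RP.XXd s t‖ ≤ K * ((t - s) ^ β) ^ 2
  hη'b : ∀ s, A ≤ s → s ≤ B → ‖η' s‖ ≤ K
  hη' : ∀ s t, A ≤ s → s ≤ t → t ≤ B → ‖η' t - η' s‖ ≤ K * (t - s) ^ β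
  hη : ∀ s t, A ≤ s → s ≤ t → t ≤ B →
    ‖η t - η s - η' s (RP.X (t - r) - RP.X (s - r))‖ ≤ K * ((t - s) ^ β) ^ 2

lemma XX_self (RP : DelayedRoughPath d r γ) (s : ℝ) : RP.XX s s = 0 := by
  have h := RP.chen s s s
  funext i j
  have := congrFun (congrFun h i) j
  simpa using this

lemma XXd_self (RP : DelayedRoughPath d r γ) (s : ℝ) : RP.XXd s s = 0 := by
  have h := RP.chend s s s
  funext i j
  have := congrFun (congrFun h i) j
  simpa using this

lemma nu_self (RP : DelayedRoughPath d r γ) (σ : W × W → (Fin d → ℝ) →L[ℝ] W) (η : ℝ → W)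
    (η' : ℝ → (Fin d → ℝ) →L[ℝ] W) (s : ℝ) (x : W) : nu RP σ η η' s s x = 0 := by
  simp [nu, step, step2, XX_self, XXd_self, apply2_zero_right]

lemma rpow_three {x β : ℝ} (hx : 0 ≤ x) : x ^ (3 * β) = (x ^ β) ^ 3 := by
  rw [mul_comm, Real.rpow_mul hx]; norm_cast

lemma rpow_two' {x β : ℝ} (hx : 0 ≤ x) : x ^ (2 * β) = (x ^ β) ^ 2 := by
  rw [mul_comm, Real.rpow_mul hx]; norm_cast

variable {RP : DelayedRoughPath d r γ} {β A B : ℝ} {η : ℝ → W} {η' : ℝ → (Fin d → ℝ) →L[ℝ] W}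

lemma Dat.fp (D : Dat RP σ β K A B η η') {s t : ℝ} (hs : A ≤ s) (hst : s ≤ t) (ht : t ≤ B) :
    FP (6 * K ^ 5 * (t - s) ^ β) (nu RP σ η η' s t) :=
  fp_step D.h0 D.h1 D.hd D.hK (Real.rpow_nonneg (by linarith) _) (D.ht s t hs hst ht)
    (D.hX s t hs hst ht) (D.hη'b s hs (by linarith)) (D.hXX s t hs hst ht) (D.hXXd s t hs hst ht)

lemma Dat.fp2 (D : Dat RP σ β K A B η η') {s t : ℝ} (hs : A ≤ s) (hst : s ≤ t) (ht : t ≤ B) :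
    FP (5 * K ^ 4 * ((t - s) ^ β) ^ 2) (step2 σ (η s) (η' s) (RP.XX s t) (RP.XXd s t)) :=
  fp_step2 D.h0 D.h1 D.hd D.hK (D.hη'b s hs (by linarith)) (D.hXX s t hs hst ht)
    (D.hXXd s t hs hst ht)

lemma Dat.bl (D : Dat RP σ β K A B η η') (hβ : 0 ≤ β) {s u t : ℝ} (hs : A ≤ s) (hsu : s ≤ u)
    (hut : u ≤ t) (ht : t ≤ B) :
    BL (179 * K ^ 12 * (t - s) ^ (3 * β)) (dfct (nu RP σ η η') s u t) := by
  have hK := D.hK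
  have K0 : 0 ≤ K := by linarith
  have m1 : (u - s) ^ β ≤ (t - s) ^ β := Real.rpow_le_rpow (by linarith) (by linarith) hβ
  have m2 : (t - u) ^ β ≤ (t - s) ^ β := Real.rpow_le_rpow (by linarith) (by linarith) hβ
  have n1 : 0 ≤ (u - s) ^ β := Real.rpow_nonneg (by linarith) _
  have n2 : 0 ≤ (t - u) ^ β := Real.rpow_nonneg (by linarith) _
  have hs' : s ≤ B := by linarith
  have hu' : u ≤ B := by linarith
  have hu : A ≤ u := by linarith
  rw [rpow_three (by linarith : (0:ℝ) ≤ t - s)]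
  have := bl_defect (e := (t - s) ^ β) D.dif D.h0 D.h1 D.hd hK (c₁ := η s) (c₂ := η u) (c₁' := η' s)
    (c₂' := η' u)
    (a := RP.X u - RP.X s) (b := RP.X t - RP.X u) (p := RP.X (u - r) - RP.X (s - r))
    (M₁ := RP.XX s u) (M₂ := RP.XX u t) (N₁ := RP.XXd s u) (N₂ := RP.XXd u t)
    (M := RP.XX s t) (N := RP.XXd s t) (n1.trans m1) (D.ht s t hs (by linarith) ht)
    ((D.hX s u hs hsu hu').trans (by gcongr)) ((D.hX u t hu hut ht).trans (by gcongr))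
    ((D.hXr s u hs hsu hu').trans (by gcongr)) (D.hη'b s hs hs') (D.hη'b u hu hu')
    ((D.hη' s u hs hsu hu').trans (by gcongr)) ((D.hη s u hs hsu hu').trans (by gcongr))
    ((D.hXX s u hs hsu hu').trans (by gcongr)) ((D.hXXd s u hs hsu hu').trans (by gcongr))
    ((D.hXX u t hu hut ht).trans (by gcongr)) ((D.hXXd u t hu hut ht).trans (by gcongr))
    (RP.chen s u t) (RP.chend s u t)
  have e : RP.X u - RP.X s + (RP.X t - RP.X u) = RP.X t - RP.X s := by abel
  rw [e] at this
  exact this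

lemma Dat.af (D : Dat RP σ β K A B η η') (hβ : 0 ≤ β) :
    AF β (179 * K ^ 12) A B (nu RP σ η η') := by
  have hK := D.hK
  have K0 : 0 ≤ K := by linarith
  have hk : 6 * K ^ 5 ≤ 179 * K ^ 12 := by
    have : K ^ 5 ≤ K ^ 12 := pow_le_pow_right₀ hK (by norm_num)
    nlinarith [pow_nonneg K0 12]
  refine ⟨by positivity, nu_self RP σ η η', ?_, ?_, ?_, ?_⟩
  · intro s t hs hst ht x x'
    refine ((D.fp hs hst ht).lip x x').trans ?_
    have := Real.rpow_nonneg (sub_nonneg.2 hst) β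
    gcongr
  · intro s t hs hst ht x a x' a'
    refine ((D.fp hs hst ht).four x a x' a').trans ?_
    have := Real.rpow_nonneg (sub_nonneg.2 hst) β
    gcongr
  · exact fun s u t h1 h2 h3 h4 x => (D.bl hβ h1 h2 h3 h4).bd x
  · exact fun s u t h1 h2 h3 h4 x x' => (D.bl hβ h1 h2 h3 h4).lip x x'

end Step
end SDDEP

end

noncomputable section

namespace SDDEP
open Set Filter Topology SDDE

section Sewing
variable {W : Type*} [NormedAddCommGroup W]

/-- Sum of a two-parameter function along a partition. -/
def psum (Ξ : ℝ → ℝ → W) {s t : ℝ} (P : Partition s t) : W :=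
  ∑ i ∈ Finset.range P.n, Ξ (P.pts i) (P.pts (i + 1))

/-- Convergence of sums along partitions. -/
def HasInt (Ξ : ℝ → ℝ → W) (s t : ℝ) (v : W) : Prop :=
  ∀ ε > (0:ℝ), ∃ δ > (0:ℝ), ∀ P : Partition s t, P.MeshLE δ → ‖psum Ξ P - v‖ ≤ ε

lemma part_le_pts {s t : ℝ} (P : Partition s t) : ∀ i, i ≤ P.n → s ≤ P.pts i := by
  intro i
  induction i with
  | zero => intro _; rw [P.h0]
  | succ k ih => intro h; exact (ih (by omega)).trans (P.mono k (by omega))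

lemma part_pts_le {s t : ℝ} (P : Partition s t) : ∀ i, i ≤ P.n → P.pts i ≤ t := by
  intro i hi
  obtain ⟨j, hj⟩ := Nat.exists_eq_add_of_le hi
  induction j generalizing i with
  | zero =>
    have e : i = P.n := by omega
    subst e
    exact P.hn.le
  | succ k ih =>
    exact (P.mono i (by omega)).trans (ih (i + 1) (by omega) (by omega))

lemma HasInt.congr {Ξ Ξ' : ℝ → ℝ → W} {s t : ℝ} {v : W} (h : HasInt Ξ s t v)
    (he : ∀ p q, s ≤ p → p ≤ q → q ≤ t → Ξ' p q = Ξ p q) : HasInt Ξ' s t v := by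
  intro ε hε
  obtain ⟨δ, hδ, H⟩ := h ε hε
  refine ⟨δ, hδ, fun P hP => ?_⟩
  have : psum Ξ' P = psum Ξ P := by
    refine Finset.sum_congr rfl fun i hi => ?_
    have hi := Finset.mem_range.1 hi
    exact he _ _ (part_le_pts P i (by omega)) (P.mono i hi) (part_pts_le P (i + 1) (by omega))
  rw [this]; exact H P hP

/-- The dyadic sums. -/
def dsum (Ξ : ℝ → ℝ → W) (n : ℕ) (s t : ℝ) : W :=
  ∑ i ∈ Finset.range (2 ^ n), Ξ (s + i * ((t - s) / 2 ^ n)) (s + (i + 1 : ℕ) * ((t - s) / 2 ^ n))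

lemma dsum_succ (Ξ : ℝ → ℝ → W) (n : ℕ) (s t : ℝ) :
    dsum Ξ (n + 1) s t = dsum Ξ n s ((s + t) / 2) + dsum Ξ n ((s + t) / 2) t := by
  unfold dsum
  have h2 : (2:ℝ) ^ n ≠ 0 := by positivity
  have e : 2 ^ (n + 1) = 2 ^ n + 2 ^ n := by ring
  rw [e, Finset.sum_range_add]
  congr 1
  · refine Finset.sum_congr rfl fun i _ => ?_
    congr 1
    · rw [pow_succ]; field_simp; ring
    · rw [pow_succ]; field_simp; ring
  · refine Finset.sum_congr rfl fun i _ => ?_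
    congr 1
    · push_cast; rw [pow_succ]; field_simp; ring
    · push_cast; rw [pow_succ]; field_simp; ring

lemma dsum_bound {Ξ : ℝ → ℝ → W} {A B M M' θ : ℝ}
    (hΞ : ∀ s u t, A ≤ s → s ≤ u → u ≤ t → t ≤ B →
      ‖Ξ s t - Ξ s u - Ξ u t‖ ≤ M * (t - s) ^ θ)
    (hM : 2 * (1 / 2) ^ θ * M' + M ≤ M') (hM' : 0 ≤ M') (n : ℕ) :
    ∀ s t, A ≤ s → s ≤ t → t ≤ B → ‖dsum Ξ n s t - Ξ s t‖ ≤ M' * (t - s) ^ θ := by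
  induction n with
  | zero =>
    intro s t _ hst _
    have : dsum Ξ 0 s t = Ξ s t := by simp [dsum]
    rw [this, sub_self, norm_zero]
    have := Real.rpow_nonneg (sub_nonneg.2 hst) θ
    positivity
  | succ n ih =>
    intro s t hs hst ht
    rw [dsum_succ]
    set u := (s + t) / 2 with hu
    have i1 := ih s u hs (by linarith) (by linarith)
    have i2 := ih u t (by linarith) (by linarith) ht
    have i3 := hΞ s u t hs (by linarith) (by linarith) ht
    have e1 : u - s = (1 / 2) * (t - s) := by rw [hu]; ring
    have e2 : t - u = (1 / 2) * (t - s) := by rw [hu]; ring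
    rw [e1, Real.mul_rpow (by norm_num) (by linarith)] at i1
    rw [e2, Real.mul_rpow (by norm_num) (by linarith)] at i2
    have e : dsum Ξ n s u + dsum Ξ n u t - Ξ s t = (dsum Ξ n s u - Ξ s u) +
      (dsum Ξ n u t - Ξ u t) - (Ξ s t - Ξ s u - Ξ u t) := by abel
    rw [e]
    have hp := Real.rpow_nonneg (sub_nonneg.2 hst) θ
    calc _ ≤ M' * ((1 / 2) ^ θ * (t - s) ^ θ) + M' * ((1 / 2) ^ θ * (t - s) ^ θ) +
          M * (t - s) ^ θ :=
          (norm_sub_le _ _).trans (add_le_add ((norm_add_le _ _).trans (add_le_add i1 i2)) i3)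
      _ = (2 * (1 / 2) ^ θ * M' + M) * (t - s) ^ θ := by ring
      _ ≤ _ := by gcongr

/-- The dyadic partition. -/
def dpart (n : ℕ) {s t : ℝ} (hst : s ≤ t) : Partition s t where
  n := 2 ^ n
  pts i := s + i * ((t - s) / 2 ^ n)
  h0 := by simp
  hn := by push_cast; field_simp; ring
  mono i _ := by
    have : 0 ≤ (t - s) / 2 ^ n := div_nonneg (by linarith) (by positivity)
    push_cast; nlinarith

lemma sewing_int {Ξ : ℝ → ℝ → W} {A B M θ : ℝ} (hθ : 1 < θ) (hM : 0 ≤ M)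
    (hΞ : ∀ s u t, A ≤ s → s ≤ u → u ≤ t → t ≤ B →
      ‖Ξ s t - Ξ s u - Ξ u t‖ ≤ M * (t - s) ^ θ) :
    ∃ M', 0 ≤ M' ∧ ∀ s t v, A ≤ s → s ≤ t → t ≤ B → HasInt Ξ s t v →
      ‖v - Ξ s t‖ ≤ M' * (t - s) ^ θ := by
  have hk : 2 * (1 / 2 : ℝ) ^ θ < 1 := by
    have : (1 / 2 : ℝ) ^ θ < (1 / 2) ^ (1:ℝ) :=
      Real.rpow_lt_rpow_of_exponent_gt (by norm_num) (by norm_num) hθ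
    rw [Real.rpow_one] at this; linarith
  set κ := 2 * (1 / 2 : ℝ) ^ θ with hκ
  have h1 : 0 < 1 - κ := by linarith
  refine ⟨M / (1 - κ), by positivity, ?_⟩
  intro s t v hs hst ht hv
  refine le_of_forall_pos_le_add fun ε hε => ?_
  obtain ⟨δ, hδ, H⟩ := hv ε hε
  obtain ⟨n, hn⟩ : ∃ n : ℕ, (t - s) / 2 ^ n ≤ δ := by
    obtain ⟨n, hn⟩ := pow_unbounded_of_one_lt ((t - s) / δ) (by norm_num : (1:ℝ) < 2)
    refine ⟨n, ?_⟩
    rw [div_le_iff₀ (by positivity)]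
    rw [div_lt_iff₀ hδ] at hn
    linarith
  have i1 := H (dpart n hst) (by
    intro i _
    simp only [dpart]; push_cast
    linarith)
  have i2 := dsum_bound (M' := M / (1 - κ)) hΞ (by
    rw [← hκ]; apply le_of_eq; field_simp; ring) (by positivity) n s t hs hst ht
  have e0 : psum Ξ (dpart n hst) = dsum Ξ n s t := rfl
  rw [e0, norm_sub_rev] at i1
  have e : v - Ξ s t = (v - dsum Ξ n s t) + (dsum Ξ n s t - Ξ s t) := by abel
  rw [e]
  linarith [norm_add_le (v - dsum Ξ n s t) (dsum Ξ n s t - Ξ s t)]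

lemma hasInt_of_pieces {Ξ : ℝ → ℝ → W} {y : ℝ → W} {r T C θ β : ℝ} (hr : 0 < r) (hC : 0 ≤ C)
    (hθ : 1 < θ) (hβ : 0 < β)
    (h1 : ∀ k : ℕ, ∀ s t, k * r ≤ s → s ≤ t → t ≤ (k + 1) * r → t ≤ T →
      ‖y t - y s - Ξ s t‖ ≤ C * (t - s) ^ θ)
    (h2 : ∀ k : ℕ, ∀ s t, k * r ≤ s → s ≤ t → t ≤ (k + 1) * r → t ≤ T →
      ‖y t - y s‖ ≤ C * (t - s) ^ β)
    (h3 : ∀ s t, 0 ≤ s → s ≤ t → t ≤ T → ‖Ξ s t‖ ≤ C * (t - s) ^ β)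
    {s t : ℝ} (hs : 0 ≤ s) (hst : s ≤ t) (ht : t ≤ T) : HasInt Ξ s t (y t - y s) := by
  intro ε hε
  obtain ⟨δ₁, hδ₁, H1⟩ := exists_delta (β := θ - 1) (by linarith) (C * (t - s)) (half_pos hε)
  obtain ⟨δ₂, hδ₂, H2⟩ := exists_delta hβ (3 * C * ((⌊t / r⌋₊ : ℝ) - ⌊s / r⌋₊)) (half_pos hε)
  set a := C * δ₁ ^ (θ - 1) with ha
  set b := 3 * C * δ₂ ^ β with hb
  set G : ℝ → ℝ := fun x => a * x + b * (⌊x / r⌋₊ : ℝ) with hG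
  refine ⟨min r (min δ₁ δ₂), by positivity, fun P hP => ?_⟩
  have key : ∀ p q, s ≤ p → p ≤ q → q ≤ t → q - p ≤ min r (min δ₁ δ₂) →
      ‖Ξ p q - (y q - y p)‖ ≤ G q - G p := by
    intro p q hp hpq hq hm
    have m1 : q - p ≤ r := hm.trans (min_le_left _ _)
    have m2 : q - p ≤ δ₁ := hm.trans ((min_le_right _ _).trans (min_le_left _ _))
    have m3 : q - p ≤ δ₂ := hm.trans ((min_le_right _ _).trans (min_le_right _ _))
    have hp0 : 0 ≤ p := hs.trans hp
    have hq0 : 0 ≤ q := hp0.trans hpq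
    have f1 : (⌊p / r⌋₊ : ℝ) ≤ p / r := Nat.floor_le (by positivity)
    have f2 : p / r < (⌊p / r⌋₊ : ℝ) + 1 := Nat.lt_floor_add_one _
    have f3 : (⌊q / r⌋₊ : ℝ) ≤ q / r := Nat.floor_le (by positivity)
    have f4 : q / r < (⌊q / r⌋₊ : ℝ) + 1 := Nat.lt_floor_add_one _
    rw [le_div_iff₀ hr] at f1 f3
    rw [div_lt_iff₀ hr] at f2 f4
    have hfl : ⌊p / r⌋₊ ≤ ⌊q / r⌋₊ := Nat.floor_mono (by gcongr)
    have hqp : 0 ≤ q - p := by linarith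
    have ha0 : 0 ≤ a := by positivity
    have hb0 : 0 ≤ b := by positivity
    rw [norm_sub_rev]
    have hGe : G q - G p = a * (q - p) + b * ((⌊q / r⌋₊ : ℝ) - ⌊p / r⌋₊) := by
      simp only [hG]; ring
    rw [hGe]
    rcases hfl.eq_or_lt with he | hlt
    · rw [← he] at f4
      have := h1 ⌊p / r⌋₊ p q f1 hpq f4.le (hq.trans ht)
      rw [← he, sub_self, mul_zero, add_zero]
      refine this.trans ?_
      rcases hqp.eq_or_lt with h0 | h0
      · rw [← h0, Real.zero_rpow (by linarith)]; simp
      · have e : (q - p) ^ θ = (q - p) ^ (θ - 1) * (q - p) := by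
          rw [Real.rpow_sub_one h0.ne']; field_simp
        rw [e, ← mul_assoc, ha]
        have : (q - p) ^ (θ - 1) ≤ δ₁ ^ (θ - 1) := Real.rpow_le_rpow hqp m2 (by linarith)
        gcongr
    · have hc : (⌊p / r⌋₊ : ℝ) + 1 ≤ ⌊q / r⌋₊ := by exact_mod_cast hlt
      have hpow : ∀ x, 0 ≤ x → x ≤ q - p → C * x ^ β ≤ C * δ₂ ^ β := by
        intro x hx hx'
        have : x ^ β ≤ δ₂ ^ β := Real.rpow_le_rpow hx (hx'.trans m3) hβ.le
        gcongr
      set m := ((⌊p / r⌋₊ : ℝ) + 1) * r with hm'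
      have hmq : m ≤ q := by
        have : m ≤ (⌊q / r⌋₊ : ℝ) * r := by rw [hm']; gcongr
        linarith
      have g1 := (h2 ⌊p / r⌋₊ p m f1 f2.le le_rfl (by linarith)).trans
        (hpow _ (by linarith) (by linarith))
      have g2 := (h2 (⌊p / r⌋₊ + 1) m q (by push_cast; exact hm'.ge) hmq
        (by push_cast; linarith) (by linarith)).trans
        (hpow _ (by linarith) (by linarith))
      have g3 := (h3 p q hp0 hpq (by linarith)).trans (hpow _ hqp le_rfl)
      have e : y q - y p - Ξ p q = (y q - y m) + (y m - y p) - Ξ p q := by abel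
      have n1 := norm_sub_le ((y q - y m) + (y m - y p)) (Ξ p q)
      have n2 := norm_add_le (y q - y m) (y m - y p)
      rw [← e] at n1
      have : b * 1 ≤ b * ((⌊q / r⌋₊ : ℝ) - ⌊p / r⌋₊) := by gcongr; linarith
      have h4 : 0 ≤ a * (q - p) := by positivity
      have h5 : b = 3 * (C * δ₂ ^ β) := by rw [hb]; ring
      linarith
  have e1 : psum Ξ P - (y t - y s) =
      ∑ i ∈ Finset.range P.n, (Ξ (P.pts i) (P.pts (i + 1)) - (y (P.pts (i + 1)) - y (P.pts i))) := by
    rw [Finset.sum_sub_distrib, Finset.sum_range_sub (fun i => y (P.pts i)), P.h0, P.hn]; rfl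
  rw [e1]
  calc _ ≤ ∑ i ∈ Finset.range P.n, (G (P.pts (i + 1)) - G (P.pts i)) := by
        refine (norm_sum_le _ _).trans (Finset.sum_le_sum fun i hi => ?_)
        have hi := Finset.mem_range.1 hi
        exact key _ _ (part_le_pts P i (by omega)) (P.mono i hi) (part_pts_le P (i + 1) (by omega))
          (hP i hi)
    _ = G t - G s := by
        rw [Finset.sum_range_sub (fun i => G (P.pts i)), P.h0, P.hn]
    _ = C * (t - s) * δ₁ ^ (θ - 1) + 3 * C * ((⌊t / r⌋₊ : ℝ) - ⌊s / r⌋₊) * δ₂ ^ β := by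
        simp only [hG, ha, hb]; ring
    _ ≤ ε := by linarith

end Sewing
end SDDEP

end

noncomputable section

namespace SDDEP
open Set Filter Topology SDDE

section Conc
variable {W : Type*} [NormedAddCommGroup W] [NormedSpace ℝ W] {d : ℕ} {r γ β : ℝ}
  {RP : DelayedRoughPath d r γ} {σ : W × W → (Fin d → ℝ) →L[ℝ] W}

lemma rpow_weak {C γ β l x : ℝ} (hx : 0 ≤ x) (hxl : x ≤ l) (hβ : 0 ≤ β) (h : β ≤ γ) :
    C * x ^ γ ≤ |C| * l ^ (γ - β) * x ^ β := by
  have e : x ^ γ = x ^ (γ - β) * x ^ β := by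
    rw [← Real.rpow_add_of_nonneg hx (by linarith) hβ]; congr 1; ring
  have h1 : x ^ (γ - β) ≤ l ^ (γ - β) := Real.rpow_le_rpow hx hxl (by linarith)
  have h2 : 0 ≤ x ^ (γ - β) := Real.rpow_nonneg hx _
  have h3 : 0 ≤ x ^ β := Real.rpow_nonneg hx _
  rw [e, mul_assoc]
  calc _ ≤ |C| * (x ^ (γ - β) * x ^ β) := by gcongr; exact le_abs_self C
    _ ≤ _ := by gcongr

lemma rp_bounds (RP : DelayedRoughPath d r γ) (hβ : 0 ≤ β) (hβγ : β ≤ γ) (A B : ℝ)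
    (hAB : A ≤ B) : ∃ K : ℝ, 0 ≤ K ∧
      ∀ s t, A ≤ s → s ≤ t → t ≤ B → (t - s) ^ β ≤ K ∧ ‖RP.X t - RP.X s‖ ≤ K * (t - s) ^ β ∧
        ‖RP.X (t - r) - RP.X (s - r)‖ ≤ K * (t - s) ^ β ∧ ‖RP.XX s t‖ ≤ K * ((t - s) ^ β) ^ 2 ∧
        ‖RP.XXd s t‖ ≤ K * ((t - s) ^ β) ^ 2 := by
  obtain ⟨c1, h1⟩ := RP.holX A B
  obtain ⟨c2, h2⟩ := RP.holX (A - r) (B - r)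
  obtain ⟨c3, h3⟩ := RP.holXX A B
  obtain ⟨c4, h4⟩ := RP.holXXd A B
  have hl : 0 ≤ B - A := by linarith
  set l := B - A
  have p1 : 0 ≤ |c1| * l ^ (γ - β) := by positivity
  have p2 : 0 ≤ |c2| * l ^ (γ - β) := by positivity
  have p3 : 0 ≤ |c3| * l ^ (2 * γ - 2 * β) := by positivity
  have p4 : 0 ≤ |c4| * l ^ (2 * γ - 2 * β) := by positivity
  have p5 : 0 ≤ l ^ β := by positivity
  refine ⟨l ^ β + |c1| * l ^ (γ - β) + |c2| * l ^ (γ - β) + |c3| * l ^ (2 * γ - 2 * β) +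
    |c4| * l ^ (2 * γ - 2 * β), by positivity, ?_⟩
  intro s t hs hst ht
  have hx : 0 ≤ t - s := by linarith
  have hxl : t - s ≤ l := by simp only [l]; linarith
  have hsI : s ∈ Icc A B := ⟨hs, by linarith⟩
  have htI : t ∈ Icc A B := ⟨by linarith, ht⟩
  have hsI' : s - r ∈ Icc (A - r) (B - r) := ⟨by linarith, by linarith⟩
  have htI' : t - r ∈ Icc (A - r) (B - r) := ⟨by linarith, by linarith⟩
  have b1 := h1 s hsI t htI
  have b2 := h2 _ hsI' _ htI'
  have b3 := h3 s hsI t htI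
  have b4 := h4 s hsI t htI
  rw [sub_sub_sub_cancel_right] at b2
  rw [abs_of_nonneg hx] at b1 b2 b3 b4
  have e0 : 0 ≤ (t - s) ^ β := Real.rpow_nonneg hx _
  refine ⟨?_, b1.trans ((rpow_weak hx hxl hβ hβγ).trans ?_),
    b2.trans ((rpow_weak hx hxl hβ hβγ).trans ?_),
    b3.trans ((rpow_weak hx hxl (by linarith) (by linarith : 2 * β ≤ 2 * γ)).trans ?_),
    b4.trans ((rpow_weak hx hxl (by linarith) (by linarith : 2 * β ≤ 2 * γ)).trans ?_)⟩
  · have : (t - s) ^ β ≤ l ^ β := Real.rpow_le_rpow hx hxl hβ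
    linarith
  · gcongr; linarith
  · gcongr; linarith
  · rw [rpow_two' hx]; gcongr; linarith
  · rw [rpow_two' hx]; gcongr; linarith

lemma exists_dat (RP : DelayedRoughPath d r γ) (hσ : CnBounded 3 σ) (hβ : 0 ≤ β) (hβγ : β ≤ γ)
    {A B : ℝ} (hAB : A ≤ B)
    {m : ℝ → W} {m' : ℝ → (Fin d → ℝ) →L[ℝ] W}
    (hm : IsControlled β RP.X (Icc (A - r) (B - r)) m m') :
    ∃ K, Dat RP σ β K A B (fun τ => m (τ - r)) (fun τ => m' (τ - r)) := by
  obtain ⟨L, hdif, hL0, hL1⟩ := fp_of_cn hσ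
  obtain ⟨K, hK, H⟩ := rp_bounds RP hβ hβγ A B hAB
  obtain ⟨⟨c1, h1⟩, c2, h2⟩ := hm
  have hl : 0 ≤ B - A := by linarith
  have q1 := hL0.L0
  have q2 : (0:ℝ) ≤ (d:ℝ) ^ 2 := by positivity
  have q3 := abs_nonneg c1
  have q4 := abs_nonneg c2
  have q5 := norm_nonneg (m' (A - r))
  have q6 : 0 ≤ |c1| * (B - A) ^ β := by positivity
  set R := 1 + L + K + (d:ℝ) ^ 2 + |c1| + |c2| + ‖m' (A - r)‖ + |c1| * (B - A) ^ β with hR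
  have hin : ∀ s, A ≤ s → s ≤ B → s - r ∈ Icc (A - r) (B - r) :=
    fun s h h' => ⟨by linarith, by linarith⟩
  have hm' : ∀ s t, A ≤ s → s ≤ t → t ≤ B → ‖m' (t - r) - m' (s - r)‖ ≤ |c1| * (t - s) ^ β := by
    intro s t hs hst ht
    have := h1 _ (hin s hs (by linarith)) _ (hin t (by linarith) ht)
    rw [sub_sub_sub_cancel_right, abs_of_nonneg (by linarith)] at this
    have e0 : 0 ≤ (t - s) ^ β := Real.rpow_nonneg (by linarith) _
    exact this.trans (by gcongr; exact le_abs_self _)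
  refine ⟨R, ?_, hdif, hL0.le ?_, hL1.le ?_, ?_, ?_, ?_, ?_, ?_, ?_, ?_, ?_, ?_⟩
  · linarith
  · linarith
  · linarith
  · linarith
  · intro s t hs hst ht
    have := (H s t hs hst ht).1
    linarith
  · intro s t hs hst ht
    have e0 : 0 ≤ (t - s) ^ β := Real.rpow_nonneg (by linarith) _
    exact (H s t hs hst ht).2.1.trans (by gcongr; linarith)
  · intro s t hs hst ht
    have e0 : 0 ≤ (t - s) ^ β := Real.rpow_nonneg (by linarith) _
    exact (H s t hs hst ht).2.2.1.trans (by gcongr; linarith)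
  · intro s t hs hst ht
    exact (H s t hs hst ht).2.2.2.1.trans (by gcongr; linarith)
  · intro s t hs hst ht
    exact (H s t hs hst ht).2.2.2.2.trans (by gcongr; linarith)
  · intro s hs hs'
    have := hm' A s le_rfl hs hs'
    have h5 : (s - A) ^ β ≤ (B - A) ^ β := Real.rpow_le_rpow (by linarith) (by linarith) hβ
    have h6 : |c1| * (s - A) ^ β ≤ |c1| * (B - A) ^ β := by gcongr
    have h7 := norm_le_norm_add_norm_sub' (m' (s - r)) (m' (A - r))
    linarith
  · intro s t hs hst ht
    have e0 : 0 ≤ (t - s) ^ β := Real.rpow_nonneg (by linarith) _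
    exact (hm' s t hs hst ht).trans (by gcongr; linarith)
  · intro s t hs hst ht
    have := h2 _ (hin s hs (by linarith)) _ (hin t (by linarith) ht)
    rw [sub_sub_sub_cancel_right, abs_of_nonneg (by linarith), rpow_two' (by linarith)] at this
    refine this.trans ?_
    gcongr
    linarith [le_abs_self c2]

variable {K A B C : ℝ} {η : ℝ → W} {η' : ℝ → (Fin d → ℝ) →L[ℝ] W} {y : ℝ → W}

lemma dav_bounds (D : Dat RP σ β K A B η η') (hC : 0 ≤ C) (hy : Dav β C A B (nu RP σ η η') y) :
    ∃ C', 0 ≤ C' ∧ ∀ s t, A ≤ s → s ≤ t → t ≤ B →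
      ‖y t - y s - σ (y s, η s) (RP.X t - RP.X s)‖ ≤ C' * ((t - s) ^ β) ^ 2 ∧
      ‖y t - y s‖ ≤ C' * (t - s) ^ β ∧
      ‖σ (y t, η t) - σ (y s, η s)‖ ≤ C' * (t - s) ^ β := by
  have hK := D.hK
  have K0 : 0 ≤ K := by linarith
  set C₁ := C * K + 5 * K ^ 4 with hC₁
  set C₂ := C₁ * K + K * K with hC₂
  have n1 : 0 ≤ C₁ := by positivity
  have n2 : 0 ≤ C₂ := by positivity
  refine ⟨C₁ + C₂ + K * (C₂ + 2 * K ^ 2), by positivity, ?_⟩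
  intro s t hs hst ht
  have hx : 0 ≤ t - s := by linarith
  have he : 0 ≤ (t - s) ^ β := Real.rpow_nonneg hx _
  have heK := D.ht s t hs hst ht
  have hX := D.hX s t hs hst ht
  have hd := hy s t hs hst ht
  rw [rpow_three hx] at hd
  set e := (t - s) ^ β with hedef
  have b1 : ‖y t - y s - σ (y s, η s) (RP.X t - RP.X s)‖ ≤ C₁ * e ^ 2 := by
    have h2 := (D.fp2 hs hst ht).bd (y s)
    have e1 : y t - y s - σ (y s, η s) (RP.X t - RP.X s) =
        (y t - y s - nu RP σ η η' s t (y s)) +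
          step2 σ (η s) (η' s) (RP.XX s t) (RP.XXd s t) (y s) := by
      simp only [nu, step]; abel
    rw [e1]
    calc _ ≤ C * e ^ 3 + 5 * K ^ 4 * e ^ 2 := (norm_add_le _ _).trans (add_le_add hd h2)
      _ = (C * e + 5 * K ^ 4) * e ^ 2 := by ring
      _ ≤ (C * K + 5 * K ^ 4) * e ^ 2 := by gcongr
  have b2 : ‖y t - y s‖ ≤ C₂ * e := by
    have e1 : y t - y s = (y t - y s - σ (y s, η s) (RP.X t - RP.X s)) +
      σ (y s, η s) (RP.X t - RP.X s) := by abel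
    rw [e1]
    calc _ ≤ C₁ * e ^ 2 + ‖σ (y s, η s)‖ * ‖RP.X t - RP.X s‖ :=
          (norm_add_le _ _).trans (add_le_add b1 (ContinuousLinearMap.le_opNorm _ _))
      _ ≤ C₁ * e ^ 2 + K * (K * e) := by gcongr; exact D.h0.bd _
      _ = (C₁ * e + K * K) * e := by ring
      _ ≤ (C₁ * K + K * K) * e := by gcongr
  have b3 : ‖η t - η s‖ ≤ 2 * K ^ 2 * e := by
    have e1 : η t - η s = (η t - η s - η' s (RP.X (t - r) - RP.X (s - r))) +
      η' s (RP.X (t - r) - RP.X (s - r)) := by abel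
    rw [e1]
    have := D.hXr s t hs hst ht
    have := D.hη'b s hs (by linarith)
    calc _ ≤ K * e ^ 2 + ‖η' s‖ * ‖RP.X (t - r) - RP.X (s - r)‖ :=
          (norm_add_le _ _).trans (add_le_add (D.hη s t hs hst ht)
            (ContinuousLinearMap.le_opNorm _ _))
      _ ≤ K * e ^ 2 + K * (K * e) := by gcongr
      _ = (K * e + K * K) * e := by ring
      _ ≤ (K * K + K * K) * e := by gcongr
      _ = _ := by ring
  have b4 : ‖σ (y t, η t) - σ (y s, η s)‖ ≤ K * (C₂ + 2 * K ^ 2) * e := by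
    refine (D.h0.lip _ _).trans ?_
    rw [mul_assoc]
    gcongr
    rw [Prod.mk_sub_mk, Prod.norm_mk]
    have : 0 ≤ 2 * K ^ 2 * e := by positivity
    have : 0 ≤ C₂ * e := by positivity
    exact max_le (by linarith) (by linarith)
  have n3 : 0 ≤ K * (C₂ + 2 * K ^ 2) := by positivity
  refine ⟨b1.trans ?_, b2.trans ?_, b4.trans ?_⟩
  · gcongr; linarith
  · gcongr; linarith
  · gcongr; linarith

lemma dav_controlled (D : Dat RP σ β K A B η η') (hC : 0 ≤ C)
    (hy : Dav β C A B (nu RP σ η η') y) :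
    IsControlled β RP.X (Icc A B) y (fun τ => σ (y τ, η τ)) := by
  obtain ⟨C', hC', H⟩ := dav_bounds D hC hy
  have K0 : 0 ≤ K := by linarith [D.hK]
  refine ⟨⟨C', ?_⟩, C' + C' * K, ?_⟩
  · intro s hs t ht
    rcases le_total s t with h | h
    · rw [abs_of_nonneg (by linarith)]
      exact (H s t hs.1 h ht.2).2.2
    · rw [norm_sub_rev, abs_sub_comm, abs_of_nonneg (by linarith)]
      exact (H t s ht.1 h hs.2).2.2
  · intro s hs t ht
    rcases le_total s t with h | h
    · rw [abs_of_nonneg (by linarith), rpow_two' (by linarith)]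
      refine (H s t hs.1 h ht.2).1.trans ?_
      have : 0 ≤ C' * K := by positivity
      gcongr; linarith
    · rw [abs_sub_comm, abs_of_nonneg (by linarith), rpow_two' (by linarith)]
      obtain ⟨h1, h2, h3⟩ := H t s ht.1 h hs.2
      have hX := D.hX t s ht.1 h hs.2
      have he : 0 ≤ (s - t) ^ β := Real.rpow_nonneg (by linarith) _
      set e := (s - t) ^ β
      have e1 : y t - y s - σ (y s, η s) (RP.X t - RP.X s) =
          -(y s - y t - σ (y t, η t) (RP.X s - RP.X t)) +
            (σ (y s, η s) - σ (y t, η t)) (RP.X s - RP.X t) := by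
        simp only [map_sub, sub_apply]; abel
      rw [e1]
      calc _ ≤ C' * e ^ 2 + ‖σ (y s, η s) - σ (y t, η t)‖ * ‖RP.X s - RP.X t‖ := by
            refine (norm_add_le _ _).trans (add_le_add ?_ (ContinuousLinearMap.le_opNorm _ _))
            rwa [norm_neg]
        _ ≤ C' * e ^ 2 + (C' * e) * (K * e) := by gcongr
        _ = _ := by ring

lemma dav_of_int (hβ : 1 / 3 < β) (D : Dat RP σ β K A B η η')
    (hc : IsControlled β RP.X (Icc A B) y (fun τ => σ (y τ, η τ)))
    (hi : ∀ s t, A ≤ s → s ≤ t → t ≤ B →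
      HasInt (fun p q => nu RP σ η η' p q (y p)) s t (y t - y s)) :
    ∃ C, 0 ≤ C ∧ Dav β C A B (nu RP σ η η') y := by
  have K0 : 0 ≤ K := by linarith [D.hK]
  obtain ⟨-, c, hcc⟩ := hc
  set R := |c| + 5 * K ^ 4 with hR
  have hR0 : 0 ≤ R := by positivity
  obtain ⟨M', hM', H⟩ := sewing_int (θ := 3 * β) (by linarith)
    (M := 179 * K ^ 12 + 6 * K ^ 5 * R) (by positivity) (A := A) (B := B)
    (Ξ := fun p q => nu RP σ η η' p q (y p)) (by
    intro s u t hs hsu hut ht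
    have hx : 0 ≤ t - s := by linarith
    have d1 := (D.bl (by linarith) hs hsu hut ht).bd (y s)
    have b1 : ‖y s + nu RP σ η η' s u (y s) - y u‖ ≤ R * ((u - s) ^ β) ^ 2 := by
      have i1 := hcc s ⟨hs, by linarith⟩ u ⟨by linarith, by linarith⟩
      rw [abs_of_nonneg (by linarith), rpow_two' (by linarith)] at i1
      have i2 := (D.fp2 hs hsu (by linarith)).bd (y s)
      have e1 : y s + nu RP σ η η' s u (y s) - y u =
          -(y u - y s - σ (y s, η s) (RP.X u - RP.X s)) +
          step2 σ (η s) (η' s) (RP.XX s u) (RP.XXd s u) (y s) := by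
        simp only [nu, step]; abel
      rw [e1]
      calc _ ≤ c * ((u - s) ^ β) ^ 2 + 5 * K ^ 4 * ((u - s) ^ β) ^ 2 := by
            refine (norm_add_le _ _).trans (add_le_add ?_ i2)
            rwa [norm_neg]
        _ ≤ |c| * ((u - s) ^ β) ^ 2 + 5 * K ^ 4 * ((u - s) ^ β) ^ 2 := by
            gcongr; exact le_abs_self c
        _ = _ := by ring
    have l1 := (D.fp (by linarith : A ≤ u) hut ht).lip (y s + nu RP σ η η' s u (y s)) (y u)
    have m1 : (u - s) ^ β ≤ (t - s) ^ β :=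
      Real.rpow_le_rpow (by linarith) (by linarith) (by linarith)
    have m2 : (t - u) ^ β ≤ (t - s) ^ β :=
      Real.rpow_le_rpow (by linarith) (by linarith) (by linarith)
    have n1 : 0 ≤ (u - s) ^ β := Real.rpow_nonneg (by linarith) _
    have n2 : 0 ≤ (t - u) ^ β := Real.rpow_nonneg (by linarith) _
    have e : nu RP σ η η' s t (y s) - nu RP σ η η' s u (y s) - nu RP σ η η' u t (y u) =
        -dfct (nu RP σ η η') s u t (y s) +
        (nu RP σ η η' u t (y s + nu RP σ η η' s u (y s)) - nu RP σ η η' u t (y u)) := by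
      simp only [dfct]; abel
    change ‖nu RP σ η η' s t (y s) - nu RP σ η η' s u (y s) - nu RP σ η η' u t (y u)‖ ≤ _
    rw [e]
    rw [rpow_three hx] at d1 ⊢
    calc _ ≤ 179 * K ^ 12 * ((t - s) ^ β) ^ 3 +
          6 * K ^ 5 * (t - u) ^ β * ‖y s + nu RP σ η η' s u (y s) - y u‖ := by
          refine (norm_add_le _ _).trans (add_le_add ?_ l1)
          rwa [norm_neg]
      _ ≤ 179 * K ^ 12 * ((t - s) ^ β) ^ 3 +
          6 * K ^ 5 * (t - s) ^ β * (R * ((t - s) ^ β) ^ 2) := by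
          have : ‖y s + nu RP σ η η' s u (y s) - y u‖ ≤ R * ((t - s) ^ β) ^ 2 :=
            b1.trans (by gcongr)
          gcongr
      _ = _ := by ring)
  exact ⟨M', hM', fun s t hs hst ht => H s t _ hs hst ht (hi s t hs hst ht)⟩

lemma nu_bound (RP : DelayedRoughPath d r γ) (hσ : CnBounded 3 σ) (hβ : 0 ≤ β) (hβγ : β ≤ γ)
    {A B K₀ : ℝ} (hAB : A ≤ B) (η : ℝ → W)
    (hη' : ∀ s, A ≤ s → s ≤ B → ‖η' s‖ ≤ K₀) :
    ∃ C, 0 ≤ C ∧ ∀ s t x, A ≤ s → s ≤ t → t ≤ B → ‖nu RP σ η η' s t x‖ ≤ C * (t - s) ^ β := by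
  obtain ⟨L, hdif, hL0, hL1⟩ := fp_of_cn hσ
  obtain ⟨K, hK, H⟩ := rp_bounds RP hβ hβγ A B hAB
  have q1 := hL0.L0
  have q2 : (0:ℝ) ≤ (d:ℝ) ^ 2 := by positivity
  have q3 : 0 ≤ K₀ := (norm_nonneg _).trans (hη' A le_rfl hAB)
  set R := 1 + L + K + (d:ℝ) ^ 2 + K₀ with hR
  have hR1 : 1 ≤ R := by linarith
  refine ⟨6 * R ^ 5, by positivity, ?_⟩
  intro s t x hs hst ht
  obtain ⟨h1, h2, h3, h4, h5⟩ := H s t hs hst ht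
  have e0 : 0 ≤ (t - s) ^ β := Real.rpow_nonneg (by linarith) _
  refine (fp_step (K := R) (hL0.le (by linarith)) (hL1.le (by linarith)) (by linarith) hR1 e0
    (by linarith) (h2.trans ?_) ((hη' s hs (by linarith)).trans (by linarith)) (h4.trans ?_)
    (h5.trans ?_)).bd x
  · gcongr; linarith
  · gcongr; linarith
  · gcongr; linarith

end Conc
end SDDEP

end

noncomputable section

namespace SDDEP
open Set Filter Topology SDDE

lemma AF.congr' {W : Type*} [NormedAddCommGroup W] {β K A B : ℝ} {ν ν' : ℝ → ℝ → W → W}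
    (h : AF β K A B ν) (hz : ∀ s x, ν' s s x = 0)
    (he : ∀ s t, A ≤ s → s ≤ t → t ≤ B → ν' s t = ν s t) : AF β K A B ν' := by
  have hd : ∀ s u t, A ≤ s → s ≤ u → u ≤ t → t ≤ B → dfct ν' s u t = dfct ν s u t := by
    intro s u t h1 h2 h3 h4
    funext x
    simp only [dfct]
    rw [he s u h1 h2 (by linarith), he u t (by linarith) h3 h4, he s t h1 (by linarith) h4]
  refine ⟨h.K0, hz, ?_, ?_, ?_, ?_⟩
  · intro s t h1 h2 h3
    rw [he s t h1 h2 h3]; exact h.lip s t h1 h2 h3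
  · intro s t h1 h2 h3
    rw [he s t h1 h2 h3]; exact h.four s t h1 h2 h3
  · intro s u t h1 h2 h3 h4
    rw [hd s u t h1 h2 h3 h4]; exact h.dfc s u t h1 h2 h3 h4
  · intro s u t h1 h2 h3 h4
    rw [hd s u t h1 h2 h3 h4]; exact h.dfl s u t h1 h2 h3 h4

lemma dav_nu_congr {W : Type*} [NormedAddCommGroup W] {β C A B : ℝ} {ν ν' : ℝ → ℝ → W → W}
    {y : ℝ → W} (h : Dav β C A B ν y)
    (he : ∀ s t, A ≤ s → s ≤ t → t ≤ B → ν' s t = ν s t) : Dav β C A B ν' y := by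
  intro s t h1 h2 h3
  rw [he s t h1 h2 h3]; exact h s t h1 h2 h3

lemma unif {P : ℕ → ℝ → Prop} (hP : ∀ k C C', C ≤ C' → P k C → P k C') (N : ℕ)
    (h : ∀ k < N, ∃ C, P k C) : ∃ C, 0 ≤ C ∧ ∀ k < N, P k C := by
  induction N with
  | zero => exact ⟨0, le_rfl, fun k hk => by omega⟩
  | succ n ih =>
    obtain ⟨C, hC, H⟩ := ih fun k hk => h k (by omega)
    obtain ⟨C', H'⟩ := h n (by omega)
    refine ⟨max C C', hC.trans (le_max_left _ _), fun k hk => ?_⟩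
    rcases Nat.lt_succ_iff_lt_or_eq.1 hk with h1 | h1
    · exact hP k _ _ (le_max_left _ _) (H k h1)
    · subst h1; exact hP k _ _ (le_max_right _ _) H'

section Assemble
variable {W : Type*} [NormedAddCommGroup W] [NormedSpace ℝ W] {d : ℕ} {r γ β : ℝ}

lemma ctrl_mono {X : ℝ → Fin d → ℝ} {I J : Set ℝ} {m : ℝ → W} {m' : ℝ → (Fin d → ℝ) →L[ℝ] W}
    (h : IsControlled β X I m m') (hJ : J ⊆ I) : IsControlled β X J m m' := by
  obtain ⟨⟨c, h1⟩, c', h2⟩ := h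
  exact ⟨⟨c, fun s hs t ht => h1 s (hJ hs) t (hJ ht)⟩, c', fun s hs t ht => h2 s (hJ hs) t (hJ ht)⟩

lemma ctrl_congr {X : ℝ → Fin d → ℝ} {I : Set ℝ} {m n : ℝ → W} {m' n' : ℝ → (Fin d → ℝ) →L[ℝ] W}
    (h : IsControlled β X I m m') (h1 : ∀ t ∈ I, n t = m t) (h2 : ∀ t ∈ I, n' t = m' t) :
    IsControlled β X I n n' := by
  obtain ⟨⟨c, i1⟩, c', i2⟩ := h
  refine ⟨⟨c, fun s hs t ht => ?_⟩, c', fun s hs t ht => ?_⟩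
  · rw [h2 s hs, h2 t ht]; exact i1 s hs t ht
  · rw [h1 s hs, h1 t ht, h2 s hs]; exact i2 s hs t ht

/-- The approximate flow associated with a path. -/
def NN (RP : DelayedRoughPath d r γ) (σ : W × W → (Fin d → ℝ) →L[ℝ] W)
    (ξ' : ℝ → (Fin d → ℝ) →L[ℝ] W) (y : ℝ → W) : ℝ → ℝ → W → W :=
  nu RP σ (fun τ => y (τ - r)) (fun τ => solDeriv σ r ξ' y (τ - r))

/-- Derivative of the delayed path on the `k`-th piece. -/
def dk (σ : W × W → (Fin d → ℝ) →L[ℝ] W) (r : ℝ)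
    (ξ' : ℝ → (Fin d → ℝ) →L[ℝ] W) (y : ℝ → W) (k : ℕ) : ℝ → (Fin d → ℝ) →L[ℝ] W :=
  if k = 0 then ξ' else solDeriv σ r ξ' y

variable {RP : DelayedRoughPath d r γ} {σ : W × W → (Fin d → ℝ) →L[ℝ] W}
  {ξ y : ℝ → W} {ξ' : ℝ → (Fin d → ℝ) →L[ℝ] W}

lemma solDeriv_nonneg {t : ℝ} (ht : 0 ≤ t) : solDeriv σ r ξ' y t = σ (y t, y (t - r)) := by
  simp [solDeriv, not_lt.2 ht]

lemma NN_eq (k : ℕ) {s t : ℝ} (hst : s ≤ t) (ht : t ≤ (k + 1) * r) :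
    NN RP σ ξ' y s t = nu RP σ (fun τ => y (τ - r)) (fun τ => dk σ r ξ' y k (τ - r)) s t := by
  funext x
  by_cases hk : k = 0
  · subst hk
    rcases hst.eq_or_lt with h | h
    · subst h
      rw [NN, nu_self, nu_self]
    · have h0 : s - r < 0 := by
        have : t ≤ r := by simpa using ht
        linarith
      simp [NN, nu, dk, solDeriv, h0]
  · simp [NN, dk, hk]

lemma NN_congr (hr : 0 < r) {y₁ y₂ : ℝ → W} {c : ℝ} (h : ∀ t, -r ≤ t → t ≤ c → y₁ t = y₂ t)
    {s : ℝ} (hs : 0 ≤ s) (hc : s - r ≤ c) (t : ℝ) : NN RP σ ξ' y₁ s t = NN RP σ ξ' y₂ s t := by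
  have h1 : y₁ (s - r) = y₂ (s - r) := h _ (by linarith) hc
  have h2 : solDeriv σ r ξ' y₁ (s - r) = solDeriv σ r ξ' y₂ (s - r) := by
    unfold solDeriv
    split_ifs with h0
    · rfl
    · rw [h1, h (s - r - r) (by linarith) (by linarith)]
  funext x
  simp only [NN, nu]
  rw [h1, h2]

/-- Control of the delayed path on the `k`-th piece. -/
def Prev (RP : DelayedRoughPath d r γ) (σ : W × W → (Fin d → ℝ) →L[ℝ] W) (β : ℝ)
    (ξ' : ℝ → (Fin d → ℝ) →L[ℝ] W) (y : ℝ → W) (k : ℕ) (B : ℝ) : Prop :=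
  IsControlled β RP.X (Icc (k * r - r) (B - r)) y (dk σ r ξ' y k)

lemma prev_zero (hξ : IsControlled β RP.X (Icc (-r) 0) ξ ξ') (hy : ∀ t ∈ Icc (-r) 0, y t = ξ t)
    {B : ℝ} (hB : B ≤ r) : Prev RP σ β ξ' y 0 B := by
  have h1 := ctrl_congr hξ hy (fun t _ => rfl)
  have h2 := ctrl_mono h1 (J := Icc (((0:ℕ):ℝ) * r - r) (B - r)) (by
    refine Icc_subset_Icc ?_ ?_
    · simp
    · linarith)
  simpa [Prev, dk] using h2

lemma prev_succ {k : ℕ} {B B' : ℝ}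
    (h : IsControlled β RP.X (Icc (k * r) B') y (solDeriv σ r ξ' y)) (hB : B - r ≤ B') :
    Prev RP σ β ξ' y (k + 1) B := by
  have h2 := ctrl_mono h (J := Icc (((k + 1 : ℕ):ℝ) * r - r) (B - r)) (by
    refine Icc_subset_Icc ?_ hB
    push_cast; linarith)
  simpa [Prev, dk] using h2


lemma prev_dat (hσ : CnBounded 3 σ) (hβ : 1 / 3 < β) (hβγ : β < γ)
    {k : ℕ} {B : ℝ} (hkB : k * r ≤ B) (h : Prev RP σ β ξ' y k B) :
    ∃ K, Dat RP σ β K (k * r) B (fun τ => y (τ - r)) (fun τ => dk σ r ξ' y k (τ - r)) :=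
  exists_dat RP hσ (by linarith) hβγ.le hkB h

lemma prev_af (hσ : CnBounded 3 σ) (hβ : 1 / 3 < β) (hβγ : β < γ)
    {k : ℕ} {B : ℝ} (hkB : k * r ≤ B) (hB : B ≤ (k + 1) * r)
    (h : Prev RP σ β ξ' y k B) : ∃ K, AF β K (k * r) B (NN RP σ ξ' y) := by
  obtain ⟨K, D⟩ := prev_dat hσ hβ hβγ hkB h
  refine ⟨_, (D.af (by linarith)).congr' (fun s x => nu_self _ _ _ _ _ _) ?_⟩
  intro s t _ hst ht
  exact NN_eq k hst (ht.trans hB)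

lemma prev_ctrl (hσ : CnBounded 3 σ) (hβ : 1 / 3 < β) (hβγ : β < γ)
    (hr : 0 < r) {k : ℕ} {B C : ℝ} (hkB : k * r ≤ B) (hB : B ≤ (k + 1) * r)
    (h : Prev RP σ β ξ' y k B) (hC : 0 ≤ C) (hy : Dav β C (k * r) B (NN RP σ ξ' y) y) :
    IsControlled β RP.X (Icc (k * r) B) y (solDeriv σ r ξ' y) ∧
      ∃ C', ∀ s t, k * r ≤ s → s ≤ t → t ≤ B → ‖y t - y s‖ ≤ C' * (t - s) ^ β := by
  obtain ⟨K, D⟩ := prev_dat hσ hβ hβγ hkB h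
  have hy' := dav_nu_congr hy (fun s t _ hst ht => (NN_eq k hst (ht.trans hB)).symm)
  constructor
  · refine ctrl_congr (dav_controlled D hC hy') (fun t _ => rfl) ?_
    intro t ht
    have : 0 ≤ (k:ℝ) * r := by positivity
    exact solDeriv_nonneg (this.trans ht.1)
  · obtain ⟨C', _, H⟩ := dav_bounds D hC hy'
    exact ⟨C', fun s t hs hst ht => (H s t hs hst ht).2.1⟩

lemma prev_dav (hσ : CnBounded 3 σ) (hβ : 1 / 3 < β) (hβγ : β < γ)
    (hr : 0 < r) {k : ℕ} {B : ℝ} (hkB : k * r ≤ B) (hB : B ≤ (k + 1) * r)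
    (h : Prev RP σ β ξ' y k B)
    (hc : IsControlled β RP.X (Icc (k * r) B) y (solDeriv σ r ξ' y))
    (hi : ∀ s t, k * r ≤ s → s ≤ t → t ≤ B →
      HasInt (fun p q => NN RP σ ξ' y p q (y p)) s t (y t - y s)) :
    ∃ C, 0 ≤ C ∧ Dav β C (k * r) B (NN RP σ ξ' y) y := by
  obtain ⟨K, D⟩ := prev_dat hσ hβ hβγ hkB h
  have hk0 : 0 ≤ (k:ℝ) * r := by positivity
  obtain ⟨C, hC, H⟩ := dav_of_int hβ D
    (ctrl_congr hc (fun t _ => rfl) (fun t ht => (solDeriv_nonneg (hk0.trans ht.1)).symm))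
    (fun s t hs hst ht => (hi s t hs hst ht).congr fun p q hp hpq hq => by
      rw [NN_eq k hpq (by linarith)])
  exact ⟨C, hC, dav_nu_congr H (fun s t _ hst ht => NN_eq k hst (ht.trans hB))⟩


/-- The compensated increments agree with the approximate flow. -/
lemma rough_iff {s t : ℝ} (hs : 0 ≤ s) (v : W) :
    HasRoughIntegral RP (fun τ => σ (y τ, y (τ - r)))
        (zeta0 σ r y (solDeriv σ r ξ' y)) (zeta1 σ r y (solDeriv σ r ξ' y)) s t v ↔
      HasInt (fun p q => NN RP σ ξ' y p q (y p)) s t v := by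
  have he : ∀ p q, s ≤ p → p ≤ q → q ≤ t →
      NN RP σ ξ' y p q (y p) = σ (y p, y (p - r)) (RP.X q - RP.X p) +
      apply2 (zeta0 σ r y (solDeriv σ r ξ' y) p) (RP.XX p q) +
      apply2 (zeta1 σ r y (solDeriv σ r ξ' y) p) (RP.XXd p q) := by
    intro p q hp _ _
    simp only [NN, nu, step, step2, cf, zeta0, zeta1]
    rw [solDeriv_nonneg (hs.trans hp), add_assoc]
  constructor
  · intro h
    exact HasInt.congr (Ξ := fun p q => σ (y p, y (p - r)) (RP.X q - RP.X p) +
      apply2 (zeta0 σ r y (solDeriv σ r ξ' y) p) (RP.XX p q) +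
      apply2 (zeta1 σ r y (solDeriv σ r ξ' y) p) (RP.XXd p q)) h he
  · intro h
    exact HasInt.congr h (fun p q h1 h2 h3 => (he p q h1 h2 h3).symm)

/-- Davie solution on the first `N` pieces. -/
def Good (RP : DelayedRoughPath d r γ) (σ : W × W → (Fin d → ℝ) →L[ℝ] W) (β : ℝ) (ξ : ℝ → W)
    (ξ' : ℝ → (Fin d → ℝ) →L[ℝ] W) (N : ℕ) (y : ℝ → W) : Prop :=
  (∀ t ∈ Icc (-r) 0, y t = ξ t) ∧
    ∀ k : ℕ, k < N → ∃ C, 0 ≤ C ∧ Dav β C (k * r) ((k + 1) * r) (NN RP σ ξ' y) y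


lemma good_prev (hσ : CnBounded 3 σ) (hβ : 1 / 3 < β) (hβγ : β < γ)
    (hr : 0 < r) (hξ : IsControlled β RP.X (Icc (-r) 0) ξ ξ') {N : ℕ}
    (h : Good RP σ β ξ ξ' N y) : ∀ k : ℕ, k ≤ N → Prev RP σ β ξ' y k ((k + 1) * r) := by
  intro k
  induction k with
  | zero => intro _; exact prev_zero hξ h.1 (by simp)
  | succ k ih =>
    intro hk
    obtain ⟨C, hC, hd⟩ := h.2 k (by omega)
    have := (prev_ctrl hσ hβ hβγ hr (by nlinarith) le_rfl (ih (by omega)) hC hd).1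
    exact prev_succ this (by push_cast; linarith)

lemma good_succ (hσ : CnBounded 3 σ) (hβ : 1 / 3 < β) (hβγ : β < γ)
    [ProperSpace W] (hr : 0 < r) (hξ : IsControlled β RP.X (Icc (-r) 0) ξ ξ') {N : ℕ}
    (h : Good RP σ β ξ ξ' N y) : ∃ z, Good RP σ β ξ ξ' (N + 1) z := by
  have hN : (N:ℝ) * r ≤ (N + 1) * r := by nlinarith
  have hN0 : 0 ≤ (N:ℝ) * r := by positivity
  obtain ⟨K, hA⟩ := prev_af hσ hβ hβγ hN le_rfl (good_prev hσ hβ hβγ hr hξ h N le_rfl)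
  obtain ⟨w, C, hC, hw0, hw⟩ := exists_global hA hβ hN (y (N * r))
  set z : ℝ → W := fun t => if t ≤ N * r then y t else w t with hz
  have z1 : ∀ t, t ≤ N * r → z t = y t := fun t ht => by simp [hz, ht]
  have z2 : ∀ t, N * r ≤ t → z t = w t := by
    intro t ht
    rcases ht.eq_or_lt with h | h
    · rw [z1 t h.ge, ← h, hw0]
    · simp [hz, not_le.2 h]
  have hc : ∀ s t, 0 ≤ s → s ≤ (N + 1) * r → NN RP σ ξ' z s t = NN RP σ ξ' y s t := by
    intro s t hs hs'
    exact NN_congr hr (c := N * r) (fun t _ ht => z1 t ht) hs (by linarith) t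
  refine ⟨z, fun t ht => ?_, fun k hk => ?_⟩
  · rw [z1 t (ht.2.trans hN0)]; exact h.1 t ht
  · have hk0 : 0 ≤ (k:ℝ) * r := by positivity
    rcases Nat.lt_succ_iff_lt_or_eq.1 hk with h1 | h1
    · obtain ⟨C', hC', hd⟩ := h.2 k h1
      have hkN : ((k:ℝ) + 1) * r ≤ N * r := by
        have : ((k:ℝ) + 1) ≤ N := by exact_mod_cast h1
        gcongr
      refine ⟨C', hC', fun s t hs hst ht => ?_⟩
      rw [hc s t (hk0.trans hs) (by linarith), z1 t (by linarith), z1 s (by linarith)]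
      exact hd s t hs hst ht
    · subst h1
      refine ⟨C, hC, fun s t hs hst ht => ?_⟩
      rw [hc s t (hk0.trans hs) (by linarith), z2 t (by linarith), z2 s (by linarith)]
      exact hw s t hs hst ht

lemma good_exists (hσ : CnBounded 3 σ) (hβ : 1 / 3 < β) (hβγ : β < γ)
    [ProperSpace W] (hr : 0 < r) (hξ : IsControlled β RP.X (Icc (-r) 0) ξ ξ')
    (N : ℕ) : ∃ z, Good RP σ β ξ ξ' N z := by
  induction N with
  | zero => exact ⟨ξ, fun t _ => rfl, fun k hk => by omega⟩
  | succ n ih =>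
    obtain ⟨z, hz⟩ := ih
    exact good_succ hσ hβ hβγ hr hξ hz

lemma good_sol (hσ : CnBounded 3 σ) (hβ : 1 / 3 < β) (hβγ : β < γ)
    (hr : 0 < r) (hξ : IsControlled β RP.X (Icc (-r) 0) ξ ξ') {N : ℕ} {T : ℝ}
    (hT : 0 < T) (hTN : T < N * r) (h : Good RP σ β ξ ξ' N y) : IsSolOnT RP σ 0 β ξ ξ' T y := by
  have hkN : ∀ k : ℕ, (k:ℝ) * r ≤ T → k < N := by
    intro k hk
    have : (k:ℝ) < N := lt_of_mul_lt_mul_right (hk.trans_lt hTN) hr.le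
    exact_mod_cast this
  have hp : ∀ k < N, Prev RP σ β ξ' y k ((k + 1) * r) := fun k hk =>
    good_prev hσ hβ hβγ hr hξ h k hk.le
  have hb : ∀ k < N, IsControlled β RP.X (Icc (k * r) ((k + 1) * r)) y (solDeriv σ r ξ' y) ∧
      ∃ C', ∀ s t, k * r ≤ s → s ≤ t → t ≤ (k + 1) * r → ‖y t - y s‖ ≤ C' * (t - s) ^ β := by
    intro k hk
    obtain ⟨C, hC, hd⟩ := h.2 k hk
    exact prev_ctrl hσ hβ hβγ hr (by nlinarith) le_rfl (hp k hk) hC hd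
  refine ⟨h.1, fun k hk => ?_, ?_⟩
  · exact ctrl_mono (hb k (hkN k hk)).1 (Icc_subset_Icc le_rfl (min_le_left _ _))
  · obtain ⟨C₁, hC₁, H1⟩ := unif (P := fun k C => Dav β C (k * r) ((k + 1) * r) (NN RP σ ξ' y) y)
      (fun k C C' hCC hd s t hs hst ht => (hd s t hs hst ht).trans (by
        have := Real.rpow_nonneg (sub_nonneg.2 hst) (3 * β)
        gcongr)) N (fun k hk => by
          obtain ⟨C, _, hd⟩ := h.2 k hk
          exact ⟨C, hd⟩)
    obtain ⟨C₂, hC₂, H2⟩ := unif (P := fun k C => ∀ s t, k * r ≤ s → s ≤ t → t ≤ (k + 1) * r →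
        ‖y t - y s‖ ≤ C * (t - s) ^ β)
      (fun k C C' hCC hd s t hs hst ht => (hd s t hs hst ht).trans (by
        have := Real.rpow_nonneg (sub_nonneg.2 hst) β
        gcongr)) N (fun k hk => (hb k hk).2)
    obtain ⟨L, _, hL, _⟩ := fp_of_cn hσ
    have hξb : ∃ c, 0 ≤ c ∧ ∀ t ∈ Icc (-r) 0, ‖ξ' t‖ ≤ c := by
      obtain ⟨⟨c, hc⟩, -⟩ := hξ
      refine ⟨‖ξ' 0‖ + |c| * r ^ β, by positivity, fun t ht => ?_⟩
      have i1 := hc 0 ⟨by linarith, le_rfl⟩ t ht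
      have i2 : |t - 0| ^ β ≤ r ^ β := by
        refine Real.rpow_le_rpow (abs_nonneg _) ?_ (by linarith)
        rw [sub_zero, abs_of_nonpos ht.2]; linarith [ht.1]
      have i3 : c * |t - 0| ^ β ≤ |c| * r ^ β := by
        calc _ ≤ |c| * |t - 0| ^ β := by gcongr; exact le_abs_self c
          _ ≤ _ := by gcongr
      have := norm_le_norm_add_norm_sub' (ξ' t) (ξ' 0)
      linarith
    obtain ⟨c, hc0, hc⟩ := hξb
    obtain ⟨C₃, hC₃, H3⟩ := nu_bound RP hσ (by linarith : 0 ≤ β) hβγ.le (A := 0) (B := T)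
      (K₀ := c + L) hT.le (fun τ => y (τ - r)) (η' := fun τ => solDeriv σ r ξ' y (τ - r)) (by
        intro s hs _
        have := hL.L0
        simp only [solDeriv]
        split_ifs with h0
        · linarith [hc (s - r) ⟨by linarith, h0.le⟩]
        · linarith [hL.bd (y (s - r), y (s - r - r))])
    intro s t hs hst ht
    have e : y t - y s - ∫ τ in s..t, (0 : W × W →ₗ[ℝ] W) (y τ, y (τ - r)) = y t - y s := by
      simp
    rw [e, rough_iff hs]
    refine hasInt_of_pieces (C := C₁ + C₂ + C₃) (θ := 3 * β) (β := β) (T := T) hr (by positivity)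
      (by linarith) (by linarith) ?_ ?_ ?_ hs hst ht
    · intro k s t hs hst ht htT
      refine (H1 k (hkN k (by linarith)) s t hs hst ht).trans ?_
      have := Real.rpow_nonneg (sub_nonneg.2 hst) (3 * β)
      gcongr; linarith
    · intro k s t hs hst ht htT
      refine (H2 k (hkN k (by linarith)) s t hs hst ht).trans ?_
      have := Real.rpow_nonneg (sub_nonneg.2 hst) β
      gcongr; linarith
    · intro s t hs hst ht
      refine (H3 s t (y s) hs hst ht).trans ?_
      have := Real.rpow_nonneg (sub_nonneg.2 hst) β
      gcongr; linarith

lemma sol_prev (hσ : CnBounded 3 σ) (hβ : 1 / 3 < β) (hβγ : β < γ)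
    (hr : 0 < r) (hξ : IsControlled β RP.X (Icc (-r) 0) ξ ξ') {T : ℝ}
    (h : IsSolOnT RP σ 0 β ξ ξ' T y) (k : ℕ) (hk : k * r ≤ T) :
    Prev RP σ β ξ' y k (min ((k + 1) * r) T) := by
  cases k with
  | zero => exact prev_zero hξ h.1 ((min_le_left _ _).trans (by simp))
  | succ k =>
    push_cast at hk ⊢
    refine prev_succ (h.2.1 k (by linarith)) ?_
    have h1 := min_le_left (((k:ℝ) + 1 + 1) * r) T
    have h2 := min_le_right (((k:ℝ) + 1 + 1) * r) T
    exact le_min (by linarith) (by linarith)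

lemma sol_dav (hσ : CnBounded 3 σ) (hβ : 1 / 3 < β) (hβγ : β < γ)
    (hr : 0 < r) (hξ : IsControlled β RP.X (Icc (-r) 0) ξ ξ') {T : ℝ}
    (h : IsSolOnT RP σ 0 β ξ ξ' T y) (k : ℕ) (hk : k * r ≤ T) :
    ∃ C, 0 ≤ C ∧ Dav β C (k * r) (min ((k + 1) * r) T) (NN RP σ ξ' y) y := by
  refine prev_dav hσ hβ hβγ hr (le_min (by nlinarith) hk) (min_le_left _ _)
    (sol_prev hσ hβ hβγ hr hξ h k hk) (h.2.1 k hk) ?_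
  intro s t hs hst ht
  have hk0 : 0 ≤ (k:ℝ) * r := by positivity
  have := h.2.2 s t (hk0.trans hs) hst (ht.trans (min_le_right _ _))
  rw [rough_iff (hk0.trans hs)] at this
  simpa using this

lemma sol_unique (hσ : CnBounded 3 σ) (hβ : 1 / 3 < β) (hβγ : β < γ)
    (hr : 0 < r) (hξ : IsControlled β RP.X (Icc (-r) 0) ξ ξ') {T : ℝ}
    {y₁ y₂ : ℝ → W} (h₁ : IsSolOnT RP σ 0 β ξ ξ' T y₁) (h₂ : IsSolOnT RP σ 0 β ξ ξ' T y₂)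
    (k : ℕ) : ∀ t, -r ≤ t → t ≤ T → t ≤ k * r → y₁ t = y₂ t := by
  induction k with
  | zero =>
    intro t h1 _ h3
    have h3 : t ≤ 0 := by simpa using h3
    rw [h₁.1 t ⟨h1, h3⟩, h₂.1 t ⟨h1, h3⟩]
  | succ k ih =>
    intro t h1 h2 h3
    push_cast at h3
    rcases le_total t (k * r) with h | h
    · exact ih t h1 h2 h
    · have hk : (k:ℝ) * r ≤ T := h.trans h2
      have hk0 : 0 ≤ (k:ℝ) * r := by positivity
      obtain ⟨C₁, hC₁, d₁⟩ := sol_dav hσ hβ hβγ hr hξ h₁ k hk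
      obtain ⟨C₂, hC₂, d₂⟩ := sol_dav hσ hβ hβγ hr hξ h₂ k hk
      obtain ⟨K, hA⟩ := prev_af hσ hβ hβγ (le_min (by nlinarith) hk) (min_le_left _ _)
        (sol_prev hσ hβ hβγ hr hξ h₁ k hk)
      have d₂' : Dav β C₂ (k * r) (min ((k + 1) * r) T) (NN RP σ ξ' y₁) y₂ := by
        refine dav_nu_congr d₂ fun s t hs hst ht => ?_
        have q1 : t ≤ ((k:ℝ) + 1) * r := ht.trans (min_le_left _ _)
        have q2 : t ≤ T := ht.trans (min_le_right _ _)
        exact NN_congr hr (c := min (k * r) T)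
          (fun t a b => ih t a (b.trans (min_le_right _ _)) (b.trans (min_le_left _ _)))
          (hk0.trans hs) (le_min (by linarith) (by linarith)) t
      have e1 : Dav β (max C₁ C₂) (k * r) (min ((k + 1) * r) T) (NN RP σ ξ' y₁) y₁ := by
        intro s t hs hst ht
        have := Real.rpow_nonneg (sub_nonneg.2 hst) (3 * β)
        exact (d₁ s t hs hst ht).trans (by gcongr; exact le_max_left _ _)
      have e2 : Dav β (max C₁ C₂) (k * r) (min ((k + 1) * r) T) (NN RP σ ξ' y₁) y₂ := by
        intro s t hs hst ht
        have := Real.rpow_nonneg (sub_nonneg.2 hst) (3 * β)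
        exact (d₂' s t hs hst ht).trans (by gcongr; exact le_max_right _ _)
      exact unique_global hA hβ (hC₁.trans (le_max_left _ _)) e1 e2
        (ih _ (by linarith) hk le_rfl) t h (le_min h3 h2)

end Assemble
end SDDEP

end

open SDDE Set in
/-- Existence and uniqueness for the rough delay equation
`dy_t = σ(y_t, y_{t-r}) d𝐗_t` on `[0,T]` with initial condition `ξ ∈ 𝒟_X^β([-r,0])`;
the Gubinelli derivative of the solution is `y'_t = σ(y_t, y_{t-r})` (built into
`IsSolOnT`). -/
theorem sdde_existence_uniqueness
    {d : ℕ} {r γ β : ℝ} (hr : 0 < r) (hγ1 : 1 / 3 < γ) (hγ2 : γ ≤ 1 / 2)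
    (hβ1 : 1 / 3 < β) (hβγ : β < γ)
    {W : Type*} [NormedAddCommGroup W] [NormedSpace ℝ W] [FiniteDimensional ℝ W]
    (RP : DelayedRoughPath d r γ)
    (σ : W × W → (Fin d → ℝ) →L[ℝ] W) (hσ : CnBounded 3 σ)
    (ξ : ℝ → W) (ξ' : ℝ → (Fin d → ℝ) →L[ℝ] W)
    (hξ : IsControlled β RP.X (Icc (-r) 0) ξ ξ') :
    ∀ T > (0 : ℝ),
      (∃ y : ℝ → W, IsSolOnT RP σ 0 β ξ ξ' T y) ∧
        ∀ y₁ y₂ : ℝ → W, IsSolOnT RP σ 0 β ξ ξ' T y₁ → IsSolOnT RP σ 0 β ξ ξ' T y₂ →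
          ∀ t ∈ Icc (-r) T, y₁ t = y₂ t := by
  intro T hT
  obtain ⟨N, hN⟩ := exists_nat_gt (T / r)
  rw [div_lt_iff₀ hr] at hN
  constructor
  · haveI : ProperSpace W := FiniteDimensional.proper_real W
    obtain ⟨y, hy⟩ := SDDEP.good_exists (RP := RP) hσ hβ1 hβγ hr hξ N
    exact ⟨y, SDDEP.good_sol hσ hβ1 hβγ hr hξ hT hN hy⟩
  · intro y₁ y₂ h₁ h₂ t ht
    exact SDDEP.sol_unique hσ hβ1 hβγ hr hξ h₁ h₂ N t ht.1 ht.2 (ht.2.trans hN.le)
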